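/- For every k ∈ ℕ ∪ {0}: (1) A_k is a nonempty bounded open set; (2) μ_k := sup A_k belongs to I_k, and the sequence satisfies μ₀ < μ₁ < ⋯ < μ_j < μ_{j+1} < ⋯ → +∞; (3) ν_k := sup I_k < +∞ and there exists ε > 0 with (ν_k, ν_k + ε) ⊂ A_{k+1}; (4) if μ ∈ I_k, then (u_μ(t), v_μ(t)) → (0,0) as |t| → ∞, and more precisely u_μ(t)² + v_μ(t)² = O(e^{−(m−2)|t|}) as |t| → +∞; (5) if μ ∈ A_k, then u_μ(t)² + v_μ(t)² is bounded from below by a positive constant for all t ∈ ℝ, is unbounded as |t| → +∞, and there is a constant C > 0 with u_μ(t)² + v_μ(t)² ≤ C·cosh(t) for all |t| sufficiently large. -/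

import Mathlib

open Real Filter Set Topology

noncomputable section

/-- System (S2): `u' + ((m-2)/2) u = cosh(t)^{-1/(m-1)} (u²+v²)^{1/(m-1)} v`,
    `-v' + ((m-2)/2) v = cosh(t)^{-1/(m-1)} (u²+v²)^{1/(m-1)} u`. -/
def IsSolS2 (m : ℕ) (u v : ℝ → ℝ) : Prop :=
  ∀ t : ℝ,
    HasDerivAt u (Real.cosh t ^ (-(1 : ℝ) / ((m : ℝ) - 1))
        * ((u t) ^ 2 + (v t) ^ 2) ^ ((1 : ℝ) / ((m : ℝ) - 1)) * v t
      - (((m : ℝ) - 2) / 2) * u t) t ∧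
    HasDerivAt v ((((m : ℝ) - 2) / 2) * v t
      - Real.cosh t ^ (-(1 : ℝ) / ((m : ℝ) - 1))
        * ((u t) ^ 2 + (v t) ^ 2) ^ ((1 : ℝ) / ((m : ℝ) - 1)) * u t) t

/-- The (time-dependent) energy of (S2). -/
def H2 (m : ℕ) (t u v : ℝ) : ℝ :=
  -(((m : ℝ) - 2) / 2) * u * v
    + (((m : ℝ) - 1) / (2 * (m : ℝ))) * Real.cosh t ^ (-(1 : ℝ) / ((m : ℝ) - 1))
      * (u ^ 2 + v ^ 2) ^ ((m : ℝ) / ((m : ℝ) - 1))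

/-- `w` changes sign at least `k` times on `J`. -/
def ChangesSignAtLeast (w : ℝ → ℝ) (J : Set ℝ) (k : ℕ) : Prop :=
  ∃ s : ℕ → ℝ, (∀ i, i ≤ k → s i ∈ J) ∧
    (∀ i j, i < j → j ≤ k → s i < s j) ∧
    (∀ i, i + 1 ≤ k → w (s i) * w (s (i + 1)) < 0)

/-- `w` changes sign exactly `k` times on `J`. -/
def ChangesSignExactly (w : ℝ → ℝ) (J : Set ℝ) (k : ℕ) : Prop :=
  ChangesSignAtLeast w J k ∧ ¬ ChangesSignAtLeast w J (k + 1)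

/-- The energy along the solution `(u,v)` tends (as `|t| → ∞`) to a limit in `[-∞, 0)`. -/
def EnergyNegLimit (m : ℕ) (u v : ℝ → ℝ) : Prop :=
  (∃ L : ℝ, L < 0 ∧ Tendsto (fun t => H2 m t (u t) (v t)) atTop (𝓝 L) ∧
      Tendsto (fun t => H2 m t (u t) (v t)) atBot (𝓝 L)) ∨
  (Tendsto (fun t => H2 m t (u t) (v t)) atTop atBot ∧
      Tendsto (fun t => H2 m t (u t) (v t)) atBot atBot)

/-- `μ ∈ A_k`: `v_μ` changes sign exactly `k` times on `(0,∞)` and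
    `lim_{|t|→∞} H_μ(t) < 0`. -/
def setA (m k : ℕ) : Set ℝ :=
  {μ : ℝ | 0 < μ ∧ ∃ u v : ℝ → ℝ, IsSolS2 m u v ∧ u 0 = μ ∧ v 0 = μ ∧
    ChangesSignExactly v (Set.Ioi 0) k ∧ EnergyNegLimit m u v}

/-- `μ ∈ I_k`: `v_μ` changes sign exactly `k` times on `(0,∞)`, `H_μ > 0` on `ℝ`,
    and `(u_μ, v_μ)` is bounded. -/
def setI (m k : ℕ) : Set ℝ :=
  {μ : ℝ | 0 < μ ∧ ∃ u v : ℝ → ℝ, IsSolS2 m u v ∧ u 0 = μ ∧ v 0 = μ ∧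
    ChangesSignExactly v (Set.Ioi 0) k ∧
    (∀ t : ℝ, 0 < H2 m t (u t) (v t)) ∧
    ∃ M : ℝ, ∀ t : ℝ, |u t| + |v t| ≤ M}

/-! ### Elementary helpers -/

def lc (t : ℝ) : ℝ := Real.log (Real.cosh t)
def th (t : ℝ) : ℝ := Real.sinh t / Real.cosh t

lemma lc_deriv (t : ℝ) : HasDerivAt lc (th t) t := by
  unfold lc th
  exact (Real.hasDerivAt_cosh t).log (Real.cosh_pos t).ne'

lemma lc_cont : Continuous lc := continuous_iff_continuousAt.2 fun t => (lc_deriv t).continuousAt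

lemma th_nonneg {t : ℝ} (ht : 0 ≤ t) : 0 ≤ th t :=
  div_nonneg (Real.sinh_nonneg_iff.2 ht) (Real.cosh_pos t).le

lemma th_le_one (t : ℝ) : th t ≤ 1 := by
  unfold th
  rw [div_le_one (Real.cosh_pos t)]
  exact (Real.sinh_lt_cosh t).le

lemma th_half {t : ℝ} (ht : 1 ≤ t) : 1 / 2 ≤ th t := by
  unfold th
  rw [le_div_iff₀ (Real.cosh_pos t), Real.cosh_eq, Real.sinh_eq]
  have h1 : t + 1 ≤ Real.exp t := Real.add_one_le_exp t
  have h2 : Real.exp t * Real.exp (-t) = 1 := by rw [← Real.exp_add]; simp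
  have h3 := Real.exp_pos (-t)
  nlinarith

lemma lc_zero : lc 0 = 0 := by simp [lc]

lemma lc_neg (t : ℝ) : lc (-t) = lc t := by simp [lc]

lemma lc_nonneg (t : ℝ) : 0 ≤ lc t := Real.log_nonneg (Real.one_le_cosh t)

lemma exp_lc (t : ℝ) : Real.exp (lc t) = Real.cosh t := Real.exp_log (Real.cosh_pos t)

lemma lc_ge (t : ℝ) : t - 1 ≤ lc t := by
  unfold lc
  rw [Real.le_log_iff_exp_le (Real.cosh_pos t), Real.cosh_eq, Real.exp_sub]
  have := Real.exp_pos t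
  have h2 := Real.exp_pos (-t)
  have h3 : 2 ≤ Real.exp 1 := by have := Real.add_one_le_exp 1; linarith
  have h4 : Real.exp t / Real.exp 1 ≤ Real.exp t / 2 := by gcongr
  linarith

lemma le_of_der {f f' : ℝ → ℝ} {s t : ℝ} (hst : s ≤ t) (hf : ∀ x, HasDerivAt f (f' x) x)
    (h : ∀ x, s ≤ x → x ≤ t → 0 ≤ f' x) : f s ≤ f t := by
  have : MonotoneOn f (Icc s t) := by
    apply monotoneOn_of_hasDerivWithinAt_nonneg (f' := f') (convex_Icc s t)
    · exact fun x _ => (hf x).continuousAt.continuousWithinAt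
    · exact fun x _ => (hf x).hasDerivWithinAt
    · intro x hx
      rw [interior_Icc] at hx
      exact h x hx.1.le hx.2.le
  exact this (left_mem_Icc.2 hst) (right_mem_Icc.2 hst) hst

lemma ge_of_der {f f' : ℝ → ℝ} {s t : ℝ} (hst : s ≤ t) (hf : ∀ x, HasDerivAt f (f' x) x)
    (h : ∀ x, s ≤ x → x ≤ t → f' x ≤ 0) : f t ≤ f s := by
  have := le_of_der (f := fun x => - f x) (f' := fun x => - f' x) hst (fun x => (hf x).neg)
    (fun x h1 h2 => by have := h x h1 h2; linarith)
  simpa using this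

lemma lc_mono {s t : ℝ} (hs : 0 ≤ s) (h : s ≤ t) : lc s ≤ lc t :=
  le_of_der h lc_deriv (fun _ hx _ => th_nonneg (hs.trans hx))

/-- derivative bound from above -/
lemma sub_le_of_der {f f' : ℝ → ℝ} {s t c : ℝ} (hst : s ≤ t) (hf : ∀ x, HasDerivAt f (f' x) x)
    (h : ∀ x, s ≤ x → x ≤ t → f' x ≤ c) : f t - f s ≤ c * (t - s) := by
  have := ge_of_der (f := fun x => f x - c * x) (f' := fun x => f' x - c * 1) hst
    (fun x => (hf x).sub ((hasDerivAt_id x).const_mul c))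
    (fun x h1 h2 => by have := h x h1 h2; linarith)
  linarith

lemma le_sub_of_der {f f' : ℝ → ℝ} {s t c : ℝ} (hst : s ≤ t) (hf : ∀ x, HasDerivAt f (f' x) x)
    (h : ∀ x, s ≤ x → x ≤ t → c ≤ f' x) : c * (t - s) ≤ f t - f s := by
  have := sub_le_of_der (f := fun x => - f x) (f' := fun x => - f' x) (c := -c) hst
    (fun x => (hf x).neg) (fun x h1 h2 => by have := h x h1 h2; linarith)
  linarith

/-- A level that can only be crossed downwards. -/
lemma barrier {f f' : ℝ → ℝ} {c s t : ℝ} (hf : ∀ x, HasDerivAt f (f' x) x)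
    (hc : ∀ x, f x = c → f' x < 0) (h0 : f s ≤ c) (hst : s < t) : f t < c := by
  have hcont : Continuous f := continuous_iff_continuousAt.2 fun x => (hf x).continuousAt
  have h1 : ∀ ⦃x⦄, x ∈ Icc s t → f x ≤ c :=
    image_le_of_deriv_right_lt_deriv_boundary (f' := f') (B := fun _ => c) (B' := fun _ => 0)
      hcont.continuousOn (fun x _ => (hf x).hasDerivWithinAt) h0 (fun x => hasDerivAt_const x c)
      (fun x _ hx => hc x hx)
  refine lt_of_le_of_ne (h1 (right_mem_Icc.2 hst.le)) fun heq => ?_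
  have h2 := hc t heq
  have h3 := (hasDerivAt_iff_tendsto_slope.1 (hf t)).mono_left
    (nhdsWithin_mono t (fun x (hx : x ∈ Iio t) => (ne_of_lt hx : x ≠ t)))
  have h4 : 0 ≤ f' t := by
    refine ge_of_tendsto h3 ?_
    have : Ioo s t ∈ 𝓝[<] t := Ioo_mem_nhdsLT hst
    filter_upwards [this] with x hx
    rw [slope_def_field]
    have := h1 ⟨hx.1.le, hx.2.le⟩
    apply div_nonneg_of_nonpos
    · linarith
    · linarith [hx.2]
  linarith

lemma ivt {f : ℝ → ℝ} (hf : Continuous f) {s t c : ℝ} (hst : s ≤ t) (h1 : c ≤ f s)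
    (h2 : f t ≤ c) : ∃ x, s ≤ x ∧ x ≤ t ∧ f x = c := by
  obtain ⟨x, hx, h⟩ := intermediate_value_Icc' hst hf.continuousOn ⟨h2, h1⟩
  exact ⟨x, hx.1, hx.2, h⟩

/-! ### Polar form of the system -/

def En (p t x : ℝ) : ℝ := Real.exp (p * (x - lc t))

structure PSol (a p : ℝ) (ρ θ : ℝ → ℝ) : Prop where
  dr : ∀ t, HasDerivAt ρ (-(2 * a) * Real.cos (2 * θ t)) t
  dth : ∀ t, HasDerivAt θ (a * Real.sin (2 * θ t) - En p t (ρ t)) t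
  th0 : θ 0 = π / 4
  ha : 1 / 2 ≤ a
  hp : 0 < p
  hp' : p ≤ 1 / 2

/-- energy over `r`, doubled -/
def hh (a p : ℝ) (ρ θ : ℝ → ℝ) (t : ℝ) : ℝ := En p t (ρ t) / (p + 1) - a * Real.sin (2 * θ t)

def Hp (a p : ℝ) (ρ θ : ℝ → ℝ) (t : ℝ) : ℝ := Real.exp (ρ t) * hh a p ρ θ t / 2

def gg (p : ℝ) (ρ : ℝ → ℝ) (t : ℝ) : ℝ := Real.exp ((p + 1) * ρ t - p * lc t)

lemma En_pos (p t x : ℝ) : 0 < En p t x := Real.exp_pos _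
lemma gg_pos (p : ℝ) (ρ : ℝ → ℝ) (t : ℝ) : 0 < gg p ρ t := Real.exp_pos _

lemma gg_eq (p : ℝ) (ρ : ℝ → ℝ) (t : ℝ) : gg p ρ t = En p t (ρ t) * Real.exp (ρ t) := by
  unfold gg En
  rw [← Real.exp_add]; congr 1; ring

lemma sin_half (j : ℤ) : Real.sin (2 * (j * (π / 2))) = 0 := by
  rw [show 2 * ((j : ℝ) * (π / 2)) = j * π by ring]
  exact Real.sin_int_mul_pi j

lemma sin_shift (x : ℝ) (j : ℤ) : Real.sin (2 * (j * π + x)) = Real.sin (2 * x) := by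
  rw [show 2 * (j * π + x) = 2 * x + j * (2 * π) by ring]
  exact Real.sin_add_int_mul_two_pi _ _

lemma cos_shift (x : ℝ) (j : ℤ) : Real.cos (2 * (j * π + x)) = Real.cos (2 * x) := by
  rw [show 2 * (j * π + x) = 2 * x + j * (2 * π) by ring]
  exact Real.cos_add_int_mul_two_pi _ _

/-- half-period on which `sin 2θ ≤ 0` -/
lemma sin_nonpos_of {x : ℝ} (j : ℤ) (h1 : j * π - π / 2 ≤ x) (h2 : x ≤ j * π) :
    Real.sin (2 * x) ≤ 0 := by
  have : x = j * π + (x - j * π) := by ring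
  rw [this, sin_shift]
  apply Real.sin_nonpos_of_nonpos_of_neg_pi_le <;> linarith

namespace PSol

variable {a p : ℝ} {ρ θ : ℝ → ℝ}

lemma contr (S : PSol a p ρ θ) : Continuous ρ :=
  continuous_iff_continuousAt.2 fun x => (S.dr x).continuousAt
lemma contth (S : PSol a p ρ θ) : Continuous θ :=
  continuous_iff_continuousAt.2 fun x => (S.dth x).continuousAt

lemma dEn (S : PSol a p ρ θ) (t : ℝ) : HasDerivAt (fun t => En p t (ρ t))
    (En p t (ρ t) * (p * (-(2 * a) * Real.cos (2 * θ t) - th t))) t := by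
  unfold En
  exact (((S.dr t).sub (lc_deriv t)).const_mul p).exp

lemma dgg (S : PSol a p ρ θ) (t : ℝ) : HasDerivAt (gg p ρ)
    (gg p ρ t * ((p + 1) * (-(2 * a) * Real.cos (2 * θ t)) - p * th t)) t := by
  unfold gg
  exact (((S.dr t).const_mul (p + 1)).sub ((lc_deriv t).const_mul p)).exp

lemma dHp (S : PSol a p ρ θ) (t : ℝ) : HasDerivAt (Hp a p ρ θ)
    (-(p / (2 * (p + 1))) * th t * gg p ρ t) t := by
  have h1 := S.dEn t
  have h2 := ((S.dth t).const_mul 2).sin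
  have h3 := (((S.dr t).exp).mul ((h1.div_const (p + 1)).sub (h2.const_mul a))).div_const 2
  have hp := S.hp
  refine HasDerivAt.congr_deriv (f := Hp a p ρ θ) h3 ?_
  rw [gg_eq]
  have : p + 1 ≠ 0 := by positivity
  simp only [Pi.sub_apply]
  field_simp
  ring

lemma bar (S : PSol a p ρ θ) (j : ℤ) {s t : ℝ} (h0 : θ s ≤ j * (π / 2)) (hst : s < t) :
    θ t < j * (π / 2) := by
  refine barrier S.dth (fun x hx => ?_) h0 hst
  rw [hx, sin_half]
  have := En_pos p x (ρ x)
  linarith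

lemma Hp_anti (S : PSol a p ρ θ) {s t : ℝ} (hs : 0 ≤ s) (hst : s ≤ t) :
    Hp a p ρ θ t ≤ Hp a p ρ θ s := by
  refine ge_of_der hst S.dHp (fun x h1 _ => ?_)
  have hp := S.hp
  have := mul_nonneg (mul_nonneg (by positivity : 0 ≤ p / (2 * (p + 1)))
    (th_nonneg (hs.trans h1))) (gg_pos p ρ x).le
  linarith

lemma Hp_santi (S : PSol a p ρ θ) {s t : ℝ} (hs : 0 ≤ s) (hst : s < t) :
    Hp a p ρ θ t < Hp a p ρ θ s := by
  have hanti : StrictAntiOn (Hp a p ρ θ) (Ici 0) := by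
    apply strictAntiOn_of_hasDerivWithinAt_neg (f' := fun t => -(p / (2 * (p + 1))) * th t * gg p ρ t)
      (convex_Ici 0)
    · exact fun x _ => (S.dHp x).continuousAt.continuousWithinAt
    · exact fun x _ => (S.dHp x).hasDerivWithinAt
    · intro x hx
      rw [interior_Ici] at hx
      have hp := S.hp
      have h1 : 0 < th x := div_pos (Real.sinh_pos_iff.2 hx) (Real.cosh_pos x)
      have := mul_pos (mul_pos (by positivity : 0 < p / (2 * (p + 1))) h1) (gg_pos p ρ x)
      linarith
  exact hanti (mem_Ici.2 hs) (mem_Ici.2 (hs.trans hst.le)) hst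

lemma hh_pos_iff {t : ℝ} : 0 < Hp a p ρ θ t ↔ 0 < hh a p ρ θ t := by
  unfold Hp
  have := Real.exp_pos (ρ t)
  constructor
  · intro h
    by_contra h2
    push Not at h2
    nlinarith
  · intro h; positivity

lemma hh_neg_iff {t : ℝ} : Hp a p ρ θ t < 0 ↔ hh a p ρ θ t < 0 := by
  unfold Hp
  have := Real.exp_pos (ρ t)
  constructor
  · intro h
    by_contra h2
    push Not at h2
    nlinarith [mul_nonneg this.le h2]
  · intro h; nlinarith [mul_neg_of_pos_of_neg this h]

lemma hh_nonneg_iff {t : ℝ} : 0 ≤ Hp a p ρ θ t ↔ 0 ≤ hh a p ρ θ t := by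
  have := hh_neg_iff (a := a) (p := p) (ρ := ρ) (θ := θ) (t := t)
  rw [← not_lt, ← not_lt, this]

lemma sin_pos (S : PSol a p ρ θ) {t : ℝ} (h : Hp a p ρ θ t < 0) : 0 < Real.sin (2 * θ t) := by
  rw [hh_neg_iff] at h
  unfold hh at h
  have h1 : 0 < En p t (ρ t) / (p + 1) := div_pos (En_pos _ _ _) (by linarith [S.hp])
  have h2 := S.ha
  by_contra h3
  push Not at h3
  nlinarith

/-- negative energy: confinement in a quadrant -/
lemma quad (S : PSol a p ρ θ) {T t : ℝ} (hT : 0 ≤ T) (h : Hp a p ρ θ T < 0) (j : ℤ)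
    (h1 : j * π < θ T) (h2 : θ T < j * π + π / 2) (ht : T ≤ t) :
    j * π < θ t ∧ θ t < j * π + π / 2 := by
  constructor
  · by_contra hc
    push Not at hc
    obtain ⟨x, hx1, hx2, hx⟩ := ivt S.contth ht h1.le hc
    have h4 := S.sin_pos (lt_of_le_of_lt (S.Hp_anti hT hx1) h)
    have h5 := sin_nonpos_of j (x := θ x) (by linarith [Real.pi_pos]) hx.le
    linarith
  · rcases ht.eq_or_lt with rfl | ht
    · exact h2
    · have := S.bar (2 * j + 1) (s := T) (t := t) (by push_cast; linarith) ht
      push_cast at this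
      linarith

/-- every negative-energy point lies in a definite quadrant -/
lemma exists_quad (S : PSol a p ρ θ) {T : ℝ} (hT : 0 < T) (h : Hp a p ρ θ T < 0) :
    ∃ k : ℕ, -(k : ℝ) * π < θ T ∧ θ T < -(k : ℝ) * π + π / 2 := by
  have hpi := Real.pi_pos
  have h1 : θ T < π / 2 := by
    have := S.bar 1 (s := 0) (t := T) (by rw [S.th0]; push_cast; linarith) hT
    push_cast at this; linarith
  set j : ℤ := ⌊θ T / π⌋ with hj
  have h2 : (j : ℝ) * π ≤ θ T := by
    have := Int.floor_le (θ T / π)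
    rwa [le_div_iff₀ hpi] at this
  have h3 : θ T < (j + 1) * π := by
    have := Int.lt_floor_add_one (θ T / π)
    rwa [div_lt_iff₀ hpi] at this
  have h4 := S.sin_pos h
  have h5 : j ≤ 0 := by
    by_contra hc
    push Not at hc
    have : (1 : ℝ) ≤ j := by exact_mod_cast hc
    nlinarith
  have h6 : θ T < j * π + π / 2 := by
    by_contra hc
    push Not at hc
    have := sin_nonpos_of (j + 1) (x := θ T) (by push_cast; linarith) (by push_cast; linarith)
    linarith
  have h7 : (j : ℝ) * π ≠ θ T := by
    intro hc
    have := sin_nonpos_of j (x := θ T) (by linarith) hc.ge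
    linarith
  refine ⟨j.natAbs, ?_⟩
  have : ((j.natAbs : ℕ) : ℝ) = -(j : ℝ) := by
    have : ((j.natAbs : ℕ) : ℤ) = -j := by omega
    rw [← Int.cast_natCast, this, Int.cast_neg]
  rw [this, neg_neg]
  exact ⟨lt_of_le_of_ne h2 h7, h6⟩

end PSol


namespace PSol

variable {a p : ℝ} {ρ θ : ℝ → ℝ}

lemma dth_neg (S : PSol a p ρ θ) {t : ℝ} (h : 0 ≤ Hp a p ρ θ t) :
    a * Real.sin (2 * θ t) - En p t (ρ t) < 0 := by
  rw [hh_nonneg_iff] at h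
  unfold hh at h
  have h1 := En_pos p t (ρ t)
  have h2 : En p t (ρ t) / (p + 1) < En p t (ρ t) := div_lt_self h1 (by linarith [S.hp])
  linarith

lemma a_sin_le (S : PSol a p ρ θ) {t : ℝ} (h : 0 ≤ Hp a p ρ θ t) :
    a * Real.sin (2 * θ t) ≤ En p t (ρ t) := by
  linarith [S.dth_neg h]

lemma rho_lip (S : PSol a p ρ θ) {s t : ℝ} (h : s ≤ t) :
    ρ t - ρ s ≤ 2 * a * (t - s) ∧ -(2 * a) * (t - s) ≤ ρ t - ρ s := by
  have ha := S.ha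
  constructor
  · refine sub_le_of_der h S.dr fun x _ _ => ?_
    nlinarith [Real.neg_one_le_cos (2 * θ x)]
  · refine le_sub_of_der h S.dr fun x _ _ => ?_
    nlinarith [Real.cos_le_one (2 * θ x)]

lemma lc_le {t : ℝ} (ht : 0 ≤ t) : lc t ≤ t := by
  have := sub_le_of_der ht lc_deriv (c := 1) (fun x _ _ => th_le_one x)
  rw [lc_zero] at this
  linarith

/-- Step 1: logarithmic bound on `gg`. -/
lemma gg_bound (S : PSol a p ρ θ) (hH : ∀ t, 0 ≤ t → 0 ≤ Hp a p ρ θ t) :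
    ∃ B : ℝ, ∀ t, 1 ≤ t → (p + 1) * ρ t ≤ B + p * lc t := by
  have ha := S.ha
  have hp := S.hp
  set C := 2 * a * (p + 1) + p with hC
  set c := (p / (2 * (p + 1))) * (1 / 2) * Real.exp (-C) with hc
  have hcpos : 0 < c := by positivity
  have key : ∀ t, 1 ≤ t → c * gg p ρ t ≤ Hp a p ρ θ 0 := by
    intro t ht
    have hg : ∀ x, t ≤ x → x ≤ t + 1 → Real.exp (-C) * gg p ρ t ≤ gg p ρ x := by
      intro x h1 h2
      unfold gg
      rw [← Real.exp_add, Real.exp_le_exp]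
      have e1 := (S.rho_lip h1).2
      have e2 := sub_le_of_der h1 lc_deriv (c := 1) (fun x _ _ => th_le_one x)
      have e3 : -(2 * a) * (x - t) ≥ -(2 * a) := by nlinarith
      nlinarith
    have h2 := sub_le_of_der (c := -(c * gg p ρ t)) (by linarith : t ≤ t + 1) S.dHp
      (fun x h1 h2 => by
        have e1 := hg x h1 h2
        have e2 := th_half (ht.trans h1)
        have e3 := gg_pos p ρ x
        have e4 : 1 / 2 * (Real.exp (-C) * gg p ρ t) ≤ th x * gg p ρ x :=
          mul_le_mul e2 e1 (mul_nonneg (Real.exp_pos _).le (gg_pos p ρ t).le) (by linarith)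
        have e5 : 0 < p / (2 * (p + 1)) := by positivity
        have e6 := mul_le_mul_of_nonneg_left e4 e5.le
        rw [hc]
        linarith)
    have h3 := hH (t + 1) (by linarith)
    have h4 := S.Hp_anti le_rfl (by linarith : 0 ≤ t)
    linarith
  refine ⟨Real.log (Hp a p ρ θ 0 / c), fun t ht => ?_⟩
  have h1 := key t ht
  have h2 : gg p ρ t ≤ Hp a p ρ θ 0 / c := by
    rw [le_div_iff₀ hcpos]; linarith
  have h3 := Real.log_le_log (gg_pos p ρ t) h2
  unfold gg at h3
  rw [Real.log_exp] at h3
  linarith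

lemma dw (S : PSol a p ρ θ) (t : ℝ) :
    HasDerivAt (fun t => -(Real.exp (ρ t) * Real.cos (2 * θ t)))
      (Real.exp (ρ t) * (2 * a - 2 * En p t (ρ t) * Real.sin (2 * θ t))) t := by
  have h1 := ((S.dth t).const_mul 2).cos
  refine HasDerivAt.congr_deriv ((S.dr t).exp.mul h1).neg ?_
  have := Real.sin_sq_add_cos_sq (2 * θ t)
  linear_combination (-2 * a * Real.exp (ρ t)) * (-this)

lemma cos_pos_of (S : PSol a p ρ θ) {B T : ℝ}
    (hB : ∀ t, 1 ≤ t → (p + 1) * ρ t ≤ B + p * lc t) (hT : 1 ≤ T)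
    (hE : ∀ t, T ≤ t → En p t (ρ t) ≤ 1 / 4) {t : ℝ} (ht : T ≤ t) :
    0 < Real.cos (2 * θ t) := by
  by_contra hc
  push Not at hc
  have ha := S.ha
  have hp := S.hp
  have hp' := S.hp'
  set w : ℝ → ℝ := fun t => -(Real.exp (ρ t) * Real.cos (2 * θ t)) with hw
  have hw0 : 0 ≤ w t := by
    have := mul_nonneg (Real.exp_pos (ρ t)).le (neg_nonneg.2 hc)
    simp only [hw]; linarith
  have hcoef : ∀ x, t ≤ x → 1 / 2 ≤ 2 * a - 2 * En p x (ρ x) * Real.sin (2 * θ x) := by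
    intro x hx
    have h1 := hE x (ht.trans hx)
    have h2 := En_pos p x (ρ x)
    have h3 := Real.sin_le_one (2 * θ x)
    nlinarith
  have hw1 : 0 < w (t + 1) := by
    have hwt : w t ≤ w (t + 1) := le_of_der (by linarith) S.dw (fun x h1 _ =>
      mul_nonneg (Real.exp_pos _).le (by linarith [hcoef x h1]))
    rcases hw0.lt_or_eq with h | h
    · linarith
    · by_contra hcon
      have hz : ∀ x, t ≤ x → x ≤ t + 1 → w x = 0 := by
        intro x h1 h2
        have e1 : w t ≤ w x := le_of_der h1 S.dw (fun y h1 _ =>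
          mul_nonneg (Real.exp_pos _).le (by linarith [hcoef y h1]))
        have e2 : w x ≤ w (t + 1) := le_of_der h2 S.dw (fun y h3 _ =>
          mul_nonneg (Real.exp_pos _).le (by linarith [hcoef y (h1.trans h3)]))
        linarith
      have hd := S.dw (t + 1 / 2)
      have hd2 : HasDerivAt w 0 (t + 1 / 2) := by
        refine (hasDerivAt_const (t + 1 / 2) (0 : ℝ)).congr_of_eventuallyEq ?_
        filter_upwards [Ioo_mem_nhds (by linarith : t < t + 1 / 2)
          (by linarith : t + 1 / 2 < t + 1)] with x hx
        exact hz x hx.1.le hx.2.le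
      have := hd.unique hd2
      have h5 := hcoef (t + 1 / 2) (by linarith)
      have h6 := Real.exp_pos (ρ (t + 1 / 2))
      nlinarith
  have hwle : ∀ x, w x ≤ Real.exp (ρ x) := by
    intro x
    have := Real.neg_one_le_cos (2 * θ x)
    have h6 := Real.exp_pos (ρ x)
    simp only [hw]
    nlinarith
  have hy : ∀ x, t + 1 ≤ x → w (t + 1) * Real.exp (-(t + 1) / 2) ≤ w x * Real.exp (-x / 2) := by
    intro x hx
    refine le_of_der (f := fun x => w x * Real.exp (-x / 2)) hx
      (fun y => (S.dw y).mul (((hasDerivAt_id y).neg.div_const 2).exp)) ?_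
    intro y h1 _
    have h2 := hcoef y (by linarith)
    have h3 := hwle y
    have h4 := Real.exp_pos (ρ y)
    have h5 := Real.exp_pos (-y / 2)
    have : 0 ≤ Real.exp (-y / 2) * (Real.exp (ρ y) *
      (2 * a - 2 * En p y (ρ y) * Real.sin (2 * θ y)) - w y / 2) := by
      apply mul_nonneg h5.le
      nlinarith
    simp only [Pi.neg_apply, id, hw] at this ⊢
    linarith
  set y1 := w (t + 1) * Real.exp (-(t + 1) / 2) with hy1
  have hy1pos : 0 < y1 := mul_pos hw1 (Real.exp_pos _)
  have hlow : ∀ x, t + 1 ≤ x → x / 2 + Real.log y1 ≤ ρ x := by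
    intro x hx
    have h1 : y1 ≤ Real.exp (ρ x - x / 2) := by
      refine (hy x hx).trans ?_
      rw [sub_eq_add_neg, Real.exp_add, ← neg_div]
      exact mul_le_mul_of_nonneg_right (hwle x) (Real.exp_pos _).le
    have := (Real.log_le_iff_le_exp hy1pos).2 h1
    linarith
  set D := |B| + |Real.log y1| with hD
  have hx0 : t + 1 ≤ t + 12 * D + 1 := by
    have := abs_nonneg B; have := abs_nonneg (Real.log y1); linarith
  set x := t + 12 * D + 1
  have h1 := hlow x hx0
  have h2 := hB x (by linarith)
  have h3 := lc_le (by linarith : 0 ≤ x)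
  have e1 := le_abs_self B
  have e2 := neg_abs_le (Real.log y1)
  have e3 := abs_nonneg B
  have e4 := abs_nonneg (Real.log y1)
  have h4 : (p + 1) * (x / 2 + Real.log y1) ≤ B + p * x := by nlinarith
  have h5 : (p + 1) * (-|Real.log y1|) ≤ (p + 1) * Real.log y1 := by gcongr
  have hx : 12 * D + 2 ≤ x := by linarith
  nlinarith

lemma exists_round {x : ℝ} (h : 0 < Real.cos (2 * x)) :
    ∃ j : ℤ, j * π - π / 4 < x ∧ x < j * π + π / 4 := by
  have hpi := Real.pi_pos
  refine ⟨round (x / π), ?_⟩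
  set j := round (x / π)
  have h1 := abs_sub_round (x / π)
  have h2 : |x - j * π| ≤ π / 2 := by
    have : x - j * π = (x / π - j) * π := by field_simp
    rw [this, abs_mul, abs_of_pos hpi]
    nlinarith
  rw [abs_le] at h2
  have hx : x = j * π + (x - j * π) := by ring
  rw [hx, cos_shift] at h
  constructor
  · by_contra hc
    have := Real.cos_nonpos_of_pi_div_two_le_of_le (x := -(2 * (x - j * π)))
      (by linarith) (by linarith)
    rw [Real.cos_neg] at this
    linarith
  · by_contra hc
    have := Real.cos_nonpos_of_pi_div_two_le_of_le (x := (2 * (x - j * π)))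
      (by linarith) (by linarith)
    linarith

/-- The structure of solutions with everywhere nonnegative energy. -/
lemma decay (S : PSol a p ρ θ) (hH : ∀ t, 0 ≤ t → 0 ≤ Hp a p ρ θ t) :
    ∃ k : ℕ, (∀ t, 0 ≤ t → -(k : ℝ) * π < θ t) ∧
      (∃ T, 1 ≤ T ∧ ∀ t, T ≤ t → θ t < -(k : ℝ) * π + π / 4) ∧
      (∀ δ, 0 < δ → ∃ T, 1 ≤ T ∧ ∀ t, T ≤ t → En p t (ρ t) ≤ δ) ∧
      ∃ C, ∀ t, 0 ≤ t → ρ t ≤ C - 2 * a * t := by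
  have ha := S.ha
  have hp := S.hp
  have hp' := S.hp'
  have hpi := Real.pi_pos
  obtain ⟨B, hB⟩ := S.gg_bound hH
  set q := p / (p + 1) with hq
  have hqpos : 0 < q := by positivity
  have hqp : q * (p + 1) = p := by rw [hq]; field_simp
  have hEb : ∀ t, 1 ≤ t → En p t (ρ t) ≤ Real.exp (q * (B + 1 - t)) := by
    intro t ht
    unfold En
    rw [Real.exp_le_exp]
    have h1 := hB t ht
    have h2 := lc_ge t
    have h3 := mul_le_mul_of_nonneg_left h1 hqpos.le
    have h5 : p * (ρ t - lc t) ≤ q * (B - lc t) := by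
      have e1 : q * ((p + 1) * ρ t) = p * ρ t := by rw [← mul_assoc, hqp]
      have e2 : q * (p * lc t) + q * lc t = p * lc t := by
        calc q * (p * lc t) + q * lc t = q * (p + 1) * lc t := by ring
          _ = _ := by rw [hqp]
      linarith
    nlinarith
  have hEδ : ∀ δ, 0 < δ → ∃ T, 1 ≤ T ∧ ∀ t, T ≤ t → En p t (ρ t) ≤ δ := by
    intro δ hδ
    refine ⟨max 1 (B + 1 - Real.log δ / q), le_max_left _ _, fun t ht => ?_⟩
    have h1 := (le_max_left _ _).trans ht
    have h2 := (le_max_right _ _).trans ht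
    refine (hEb t h1).trans ?_
    rw [← Real.le_log_iff_exp_le hδ]
    have : q * (B + 1 - t) ≤ q * (Real.log δ / q) := by
      apply mul_le_mul_of_nonneg_left _ hqpos.le
      linarith
    rwa [mul_div_cancel₀ _ hqpos.ne'] at this
  obtain ⟨T, hT, hE⟩ := hEδ (1 / 4) (by norm_num)
  have hcos : ∀ t, T ≤ t → 0 < Real.cos (2 * θ t) := fun t ht => S.cos_pos_of hB hT hE ht
  have hdec : ∀ s t, 0 ≤ s → s ≤ t → θ t ≤ θ s := fun s t hs hst =>
    ge_of_der hst S.dth (fun x h1 _ => (S.dth_neg (hH x (hs.trans h1))).le)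
  obtain ⟨j, hj1, hj2⟩ := exists_round (hcos T le_rfl)
  have hup : ∀ t, T ≤ t → θ t < j * π + π / 4 := fun t ht =>
    (hdec T t (by linarith) ht).trans_lt hj2
  have hlow : ∀ t, T ≤ t → j * π - π / 4 < θ t := by
    intro t ht
    by_contra hc
    push Not at hc
    obtain ⟨x, h1, _, h3⟩ := ivt S.contth ht hj1.le hc
    have h4 := hcos x h1
    rw [h3, sub_eq_add_neg, cos_shift, show 2 * -(π / 4) = -(π / 2) by ring, Real.cos_neg,
      Real.cos_pi_div_two] at h4
    exact lt_irrefl _ h4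
  have hgt : ∀ t, 0 ≤ t → j * π < θ t := by
    intro t0 ht0
    by_contra hc
    push Not at hc
    set t1 := max t0 T + 1 with ht1
    have h1 : θ t1 < j * π := by
      have := S.bar (2 * j) (s := t0) (t := t1) (by push_cast; linarith)
        (by have := le_max_left t0 T; linarith)
      push_cast at this; linarith
    have hTt1 : T ≤ t1 := by have := le_max_right t0 T; linarith
    set η := j * π - θ t1 with hη
    have hη0 : 0 < η := by linarith
    have hη1 : η < π / 4 := by have := hlow t1 hTt1; linarith
    have hs : 0 < Real.sin (2 * η) := Real.sin_pos_of_pos_of_lt_pi (by linarith) (by linarith)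
    set c := a * Real.sin (2 * η) with hc
    have hcpos : 0 < c := mul_pos (by linarith) hs
    have hx : t1 ≤ t1 + π / c := by have : 0 < π / c := by positivity
                                    linarith
    have h5 := sub_le_of_der (c := -c) hx S.dth (fun x h2 _ => by
      have e1 := hlow x (hTt1.trans h2)
      have e2 := hdec t1 x (by linarith) h2
      have e3 : Real.sin (2 * θ x) ≤ - Real.sin (2 * η) := by
        have : θ x = j * π + (θ x - j * π) := by ring
        rw [this, sin_shift, ← Real.sin_neg]
        apply Real.sin_le_sin_of_le_of_le_pi_div_two <;> linarith
      have e4 := En_pos p x (ρ x)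
      have e5 := mul_le_mul_of_nonneg_left e3 (by linarith : 0 ≤ a)
      linarith)
    have h6 : -c * (t1 + π / c - t1) = -π := by field_simp; ring
    have h7 := hlow (t1 + π / c) (hTt1.trans hx)
    linarith
  have hj0 : j ≤ 0 := by
    have := hgt 0 le_rfl
    rw [S.th0] at this
    by_contra hc
    push Not at hc
    have : (1 : ℝ) ≤ j := by exact_mod_cast hc
    nlinarith
  have hk : ((j.natAbs : ℕ) : ℝ) = -(j : ℝ) := by
    have : ((j.natAbs : ℕ) : ℤ) = -j := by omega
    rw [← Int.cast_natCast, this, Int.cast_neg]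
  refine ⟨j.natAbs, ?_, ?_, hEδ, ?_⟩
  · rw [hk, neg_neg]; exact hgt
  · rw [hk, neg_neg]; exact ⟨T, hT, hup⟩
  · set K := Real.exp (q * (B + 1)) with hK
    have hanti : ∀ t, T ≤ t → ρ t + 2 * a * t + 2 * K / q * Real.exp (-q * t) ≤
        ρ T + 2 * a * T + 2 * K / q * Real.exp (-q * T) := by
      intro t ht
      refine ge_of_der (f := fun t => ρ t + 2 * a * t + 2 * K / q * Real.exp (-q * t)) ht
        (fun x => ((S.dr x).add ((hasDerivAt_id x).const_mul (2 * a))).add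
          ((((hasDerivAt_id x).const_mul (-q)).exp).const_mul (2 * K / q))) ?_
      intro x h1 _
      have e1 := hcos x h1
      have e2 : 0 ≤ Real.sin (2 * θ x) := by
        have h3 := hgt x (by linarith)
        have h4 := hup x h1
        have : θ x = j * π + (θ x - j * π) := by ring
        rw [this, sin_shift]
        apply Real.sin_nonneg_of_nonneg_of_le_pi <;> linarith
      have e3 := S.a_sin_le (hH x (by linarith))
      have e4 := hEb x (by linarith)
      have e5 : Real.exp (q * (B + 1 - x)) = K * Real.exp (-q * x) := by
        rw [hK, ← Real.exp_add]; congr 1; ring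
      have e6 : 1 - Real.cos (2 * θ x) ≤ Real.sin (2 * θ x) := by
        have := Real.sin_sq_add_cos_sq (2 * θ x)
        nlinarith [Real.sin_le_one (2 * θ x), Real.cos_le_one (2 * θ x)]
      have e7 := mul_le_mul_of_nonneg_left e6 (by linarith : 0 ≤ 2 * a)
      have e8 : 2 * K / q * (Real.exp (-q * x) * (-q * 1)) = -2 * (K * Real.exp (-q * x)) := by
        field_simp
      simp only [id]
      rw [e8]
      linarith
    refine ⟨max (ρ T + 2 * a * T + 2 * K / q * Real.exp (-q * T)) (ρ 0 + 4 * a * T),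
      fun t ht => ?_⟩
    rcases le_total T t with h | h
    · have h1 := hanti t h
      have h2 := le_max_left (ρ T + 2 * a * T + 2 * K / q * Real.exp (-q * T)) (ρ 0 + 4 * a * T)
      have h3 : 0 < 2 * K / q * Real.exp (-q * t) := by positivity
      linarith
    · have h1 := (S.rho_lip ht).1
      have h2 := le_max_right (ρ T + 2 * a * T + 2 * K / q * Real.exp (-q * T)) (ρ 0 + 4 * a * T)
      nlinarith

end PSol


namespace PSol

variable {a p : ℝ} {ρ θ : ℝ → ℝ}

lemma sin_zero_Hp (S : PSol a p ρ θ) {t : ℝ} (h : Real.sin (2 * θ t) = 0) :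
    Hp a p ρ θ t = gg p ρ t / (2 * (p + 1)) := by
  have := S.hp
  unfold Hp hh
  rw [h, gg_eq]
  field_simp
  ring

/-- After crossing `jπ` with a small rotation term the energy becomes negative
in the next admissible quadrant. -/
lemma crossing (S : PSol a p ρ θ) (j : ℤ) {t1 : ℝ} (ht1 : 1 ≤ t1) (h1 : θ t1 = j * π)
    (hE : En p t1 (ρ t1) ≤ a / 2 * Real.exp (-(6 * a))) :
    ∃ T, t1 < T ∧ Hp a p ρ θ T < 0 ∧ (j - 1) * π < θ T ∧ θ T < (j - 1) * π + π / 2 := by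
  have ha := S.ha
  have hp := S.hp
  have hp' := S.hp'
  have hpi := Real.pi_pos
  have hs1 : Real.sin (2 * θ t1) = 0 := by
    have := sin_half (2 * j); push_cast at this
    rw [h1, ← this]; congr 1; ring
  have hH1 := S.sin_zero_Hp hs1
  have hH1pos : 0 < Hp a p ρ θ t1 := by
    rw [hH1]; exact div_pos (gg_pos _ _ _) (by linarith)
  have hlt : ∀ t, t1 < t → θ t < j * π := by
    intro t ht
    have := S.bar (2 * j) (s := t1) (t := t) (by push_cast; linarith) ht
    push_cast at this; linarith
  -- the second crossing
  obtain ⟨t2, ht12, h2⟩ : ∃ t2, t1 ≤ t2 ∧ θ t2 = j * π - π / 2 := by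
    suffices h : ∃ t, t1 ≤ t ∧ θ t ≤ j * π - π / 2 by
      obtain ⟨t, e1, e2⟩ := h
      obtain ⟨x, e3, _, e4⟩ := ivt S.contth e1 (by linarith) e2
      exact ⟨x, e3, e4⟩
    by_cases hH : ∀ t, 0 ≤ t → 0 ≤ Hp a p ρ θ t
    · obtain ⟨k, hk1, ⟨T, hT, hk2⟩, -, -⟩ := S.decay hH
      refine ⟨max T t1, le_max_right _ _, ?_⟩
      have e1 := hk1 (t1 + 1) (by linarith)
      have e2 := hlt (t1 + 1) (by linarith)
      have e3 := hk2 (max T t1) (le_max_left _ _)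
      have e4 : (-(k : ℤ) : ℝ) < (j : ℝ) := by
        have : (-(k : ℝ)) * π < j * π := by linarith
        have := lt_of_mul_lt_mul_right this hpi.le
        exact_mod_cast this
      have e5 : -(k : ℤ) < j := by exact_mod_cast e4
      have e6 : -(k : ℤ) + 1 ≤ j := e5
      have e7 : -(k : ℝ) + 1 ≤ j := by exact_mod_cast e6
      nlinarith
    · push Not at hH
      obtain ⟨T, hT0, hT⟩ := hH
      have hT1 : t1 < T := by
        by_contra hc
        push Not at hc
        have := S.Hp_anti hT0 hc
        linarith
      refine ⟨T, hT1.le, ?_⟩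
      by_contra hc
      push Not at hc
      have e1 := sin_nonpos_of j hc.le (hlt T hT1).le
      have e2 := S.sin_pos hT
      linarith
  have hs2 : Real.sin (2 * θ t2) = 0 := by
    have := sin_half (2 * j - 1); push_cast at this
    rw [h2, ← this]; congr 1; ring
  have hH2 := S.sin_zero_Hp hs2
  have hgle : gg p ρ t2 ≤ gg p ρ t1 := by
    have := S.Hp_anti (by linarith) ht12
    rw [hH1, hH2] at this
    exact (div_le_div_iff_of_pos_right (by linarith)).1 this
  have hE2 : En p t2 (ρ t2) ≤ En p t1 (ρ t1) := by
    unfold gg at hgle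
    unfold En
    rw [Real.exp_le_exp] at hgle ⊢
    have e1 := lc_mono (by linarith) ht12
    have e2 : (p + 1) * (p * (ρ t2 - lc t2)) ≤ (p + 1) * (p * (ρ t1 - lc t1)) := by
      nlinarith [mul_le_mul_of_nonneg_left hgle hp.le]
    exact le_of_mul_le_mul_left e2 (by linarith)
  have hEτ : ∀ t, t2 ≤ t → t ≤ t2 + 3 / p → En p t (ρ t) ≤ a / 2 := by
    intro t e1 e2
    have e3 : En p t (ρ t) ≤ En p t2 (ρ t2) * Real.exp (6 * a) := by
      unfold En
      rw [← Real.exp_add, Real.exp_le_exp]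
      have f1 := (S.rho_lip e1).1
      have f2 := lc_mono (by linarith) e1
      have f3 : p * (t - t2) ≤ 3 := by
        have : t - t2 ≤ 3 / p := by linarith
        rwa [le_div_iff₀ hp, mul_comm] at this
      nlinarith
    have e4 : En p t2 (ρ t2) * Real.exp (6 * a) ≤ a / 2 * Real.exp (-(6 * a)) * Real.exp (6 * a) := by
      gcongr
      linarith
    have e5 : Real.exp (-(6 * a)) * Real.exp (6 * a) = 1 := by rw [← Real.exp_add]; simp
    calc _ ≤ _ := e3
      _ ≤ _ := e4
      _ = a / 2 := by rw [mul_assoc, e5, mul_one]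
  have hsinlev : ∀ x, θ x = j * π - 2 * π / 3 → 1 / 2 < Real.sin (2 * θ x) := by
    intro x hx
    have : θ x = ((j - 1 : ℤ) : ℝ) * π + π / 3 := by push_cast; linarith
    rw [this, sin_shift, show 2 * (π / 3) = π - π / 3 by ring, Real.sin_pi_sub,
      Real.sin_pi_div_three]
    have : 1 < √3 := by rw [Real.lt_sqrt] <;> norm_num
    linarith
  have hbad : ∀ x, t2 ≤ x → x ≤ t2 + 3 / p → θ x = j * π - 2 * π / 3 →
      Hp a p ρ θ x < 0 := by
    intro x e1 e2 e3
    by_contra hc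
    push Not at hc
    have f1 := S.a_sin_le hc
    have f2 := hEτ x e1 e2
    have f3 := hsinlev x e3
    nlinarith
  have h3p : 0 < 3 / p := by positivity
  have hneg : ∃ T, t2 ≤ T ∧ T ≤ t2 + 3 / p ∧ Hp a p ρ θ T < 0 := by
    by_contra hc
    push Not at hc
    have hin : ∀ t, t2 ≤ t → t ≤ t2 + 3 / p → j * π - 2 * π / 3 < θ t := by
      intro t e1 e2
      by_contra hcc
      push Not at hcc
      obtain ⟨x, f1, f2, f3⟩ := ivt S.contth e1 (by linarith) hcc
      have := hbad x f1 (f2.trans e2) f3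
      have := hc x f1 (f2.trans e2)
      linarith
    have hle : ∀ t, t2 ≤ t → θ t ≤ j * π - π / 2 := by
      intro t e1
      rcases e1.eq_or_lt with rfl | e1
      · exact h2.le
      · have := S.bar (2 * j - 1) (s := t2) (t := t) (by push_cast; linarith) e1
        push_cast at this; linarith
    have hcos : ∀ t, t2 ≤ t → t ≤ t2 + 3 / p → Real.cos (2 * θ t) ≤ -(1 / 2) := by
      intro t e1 e2
      have f1 := hin t e1 e2
      have f2 := hle t e1
      have : θ t = j * π + (θ t - j * π) := by ring
      rw [this, cos_shift]
      have f3 : Real.cos (2 * (θ t - j * π)) = - Real.cos (-(2 * (θ t - j * π)) - π) := by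
        rw [Real.cos_sub_pi, Real.cos_neg, neg_neg]
      rw [f3, ← Real.cos_pi_div_three]
      apply neg_le_neg
      apply Real.cos_le_cos_of_nonneg_of_le_pi <;> linarith
    have hg : ∀ t, t2 ≤ t → t ≤ t2 + 3 / p → gg p ρ t2 ≤ gg p ρ t := by
      intro t e1 e2
      refine le_of_der e1 S.dgg fun x f1 f2 => ?_
      apply mul_nonneg (gg_pos _ _ _).le
      have g1 := hcos x f1 (f2.trans e2)
      have g2 := th_le_one x
      have g3 : p * th x ≤ p := by nlinarith
      have g4 : a * (p + 1) ≤ (p + 1) * (-(2 * a) * Real.cos (2 * θ x)) := by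
        have := mul_le_mul_of_nonneg_left g1 (by positivity : 0 ≤ 2 * a * (p + 1))
        linarith
      nlinarith
    have hfin := sub_le_of_der (c := -(p / (2 * (p + 1)) * (1 / 2) * gg p ρ t2))
      (by linarith : t2 ≤ t2 + 3 / p) S.dHp (fun x f1 f2 => by
        have g1 := hg x f1 f2
        have g2 := th_half (by linarith : 1 ≤ x)
        have g3 : 1 / 2 * gg p ρ t2 ≤ th x * gg p ρ x :=
          mul_le_mul g2 g1 (gg_pos p ρ t2).le (by linarith)
        have e5 : 0 < p / (2 * (p + 1)) := by positivity
        have e6 := mul_le_mul_of_nonneg_left g3 e5.le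
        linarith)
    have e1 : -(p / (2 * (p + 1)) * (1 / 2) * gg p ρ t2) * (t2 + 3 / p - t2) =
        -(3 / 2) * (gg p ρ t2 / (2 * (p + 1))) := by field_simp; ring
    rw [e1, hH2] at hfin
    have e2 := hc (t2 + 3 / p) (by linarith) le_rfl
    have e3 : 0 < gg p ρ t2 / (2 * (p + 1)) := div_pos (gg_pos _ _ _) (by linarith)
    linarith
  obtain ⟨T, hT1, hT2, hT⟩ := hneg
  have ht2T : t2 < T := by
    rcases hT1.eq_or_lt with rfl | h
    · have : 0 < gg p ρ t2 / (2 * (p + 1)) := div_pos (gg_pos _ _ _) (by linarith)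
      linarith
    · exact h
  refine ⟨T, by linarith, hT, ?_, ?_⟩
  · by_contra hc
    push Not at hc
    obtain ⟨x, f1, f2, f3⟩ := ivt S.contth hT1 (c := j * π - 2 * π / 3) (by linarith)
      (by linarith)
    have g1 := hbad x f1 (f2.trans hT2) f3
    have g2 := S.quad (by linarith) g1 (j - 1) (by push_cast; linarith) (by push_cast; linarith) f2
    push_cast at g2
    linarith [g2.1]
  · have := S.bar (2 * j - 1) (s := t2) (t := T) (by push_cast; linarith) ht2T
    push_cast at this; linarith

end PSol

def InA (a p : ℝ) (ρ θ : ℝ → ℝ) (k : ℕ) : Prop :=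
  ∃ T, 0 < T ∧ Hp a p ρ θ T < 0 ∧ -(k : ℝ) * π < θ T ∧ θ T < -(k : ℝ) * π + π / 2

def InI (a p : ℝ) (ρ θ : ℝ → ℝ) (k : ℕ) : Prop :=
  (∀ t, 0 ≤ t → 0 < Hp a p ρ θ t) ∧ (∀ t, 0 ≤ t → -(k : ℝ) * π < θ t) ∧
    ∃ t, 0 < t ∧ θ t < -(k : ℝ) * π + π

namespace PSol

variable {a p : ℝ} {ρ θ : ℝ → ℝ}

lemma Hp_pos_of_nonneg (S : PSol a p ρ θ) (hH : ∀ t, 0 ≤ t → 0 ≤ Hp a p ρ θ t) (t : ℝ)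
    (ht : 0 ≤ t) : 0 < Hp a p ρ θ t :=
  (hH (t + 1) (by linarith)).trans_lt (S.Hp_santi ht (by linarith))

lemma bark (S : PSol a p ρ θ) (k : ℕ) {s t : ℝ} (h0 : θ s ≤ -(k : ℝ) * π) (hst : s < t) :
    θ t < -(k : ℝ) * π := by
  have := S.bar (-(2 * k)) (s := s) (t := t) (by push_cast; linarith) hst
  push_cast at this; linarith

lemma bark2 (S : PSol a p ρ θ) (k : ℕ) {s t : ℝ} (h0 : θ s ≤ -(k : ℝ) * π + π / 2) (hst : s ≤ t) :
    θ t ≤ -(k : ℝ) * π + π / 2 := by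
  rcases hst.eq_or_lt with rfl | hst
  · exact h0
  · have := S.bar (-(2 * k) + 1) (s := s) (t := t) (by push_cast; linarith) hst
    push_cast at this; linarith

lemma local_tri (S : PSol a p ρ θ) (k : ℕ) {T : ℝ} (hT : 1 ≤ T) (h1 : -(k : ℝ) * π < θ T)
    (h2 : θ T < -(k : ℝ) * π + π / 4) (hE : En p T (ρ T) ≤ a / 2 * Real.exp (-(6 * a))) :
    InA a p ρ θ k ∨ InI a p ρ θ k ∨ InA a p ρ θ (k + 1) := by
  have ha := S.ha
  have hp := S.hp
  have hpi := Real.pi_pos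
  by_cases hc : ∃ t, T ≤ t ∧ θ t ≤ -(k : ℝ) * π
  · right; right
    obtain ⟨t, e1, e2⟩ := hc
    obtain ⟨t1, f1, -, f2⟩ := ivt S.contth e1 h1.le e2
    have hs1 : Real.sin (2 * θ t1) = 0 := by
      have := sin_half (-(2 * k)); push_cast at this
      rw [f2, ← this]; congr 1; ring
    have hH1 := S.sin_zero_Hp hs1
    have hH1pos : 0 < Hp a p ρ θ t1 := by
      rw [hH1]; exact div_pos (gg_pos _ _ _) (by linarith)
    have hHx : ∀ x, T ≤ x → x ≤ t1 → 0 < Hp a p ρ θ x := fun x g1 g2 =>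
      hH1pos.trans_le (S.Hp_anti (by linarith) g2)
    have hE1 : En p t1 (ρ t1) ≤ En p T (ρ T) := by
      refine ge_of_der f1 S.dEn fun x g1 g2 => ?_
      have g3 : θ x ≤ θ T := ge_of_der g1 S.dth fun y k1 k2 =>
        (S.dth_neg (hHx y k1 (k2.trans g2)).le).le
      have g4 : -(k : ℝ) * π ≤ θ x := by
        rw [← f2]
        exact ge_of_der g2 S.dth fun y k1 k2 =>
          (S.dth_neg (hHx y (g1.trans k1) k2).le).le
      have g5 : 0 ≤ Real.cos (2 * θ x) := by
        have : θ x = ((-(k : ℤ) : ℤ) : ℝ) * π + (θ x + k * π) := by push_cast; ring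
        rw [this, cos_shift]
        apply Real.cos_nonneg_of_neg_pi_div_two_le_of_le <;> linarith
      have g6 := th_nonneg (by linarith : 0 ≤ x)
      have g7 : -(2 * a) * Real.cos (2 * θ x) - th x ≤ 0 := by nlinarith
      exact mul_nonpos_of_nonneg_of_nonpos (En_pos _ _ _).le
        (mul_nonpos_of_nonneg_of_nonpos hp.le g7)
    obtain ⟨T', l1, l2, l3, l4⟩ := S.crossing (-(k : ℤ)) (by linarith : 1 ≤ t1)
      (by push_cast; exact f2) (hE1.trans hE)
    refine ⟨T', by linarith, l2, ?_, ?_⟩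
    · push_cast at l3 ⊢; linarith
    · push_cast at l4 ⊢; linarith
  · push Not at hc
    have hall : ∀ t, 0 ≤ t → -(k : ℝ) * π < θ t := by
      intro t ht
      rcases le_or_gt T t with h | h
      · exact hc t h
      · by_contra hcc
        push Not at hcc
        linarith [S.bark k hcc h]
    by_cases hH : ∀ t, 0 ≤ t → 0 ≤ Hp a p ρ θ t
    · right; left
      exact ⟨S.Hp_pos_of_nonneg hH, hall, T, by linarith, by linarith⟩
    · left
      push Not at hH
      obtain ⟨T', e1, e2⟩ := hH
      have g1 := le_max_left T T'
      have g2 := le_max_right T T'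
      refine ⟨max T T' + 1, by linarith, (S.Hp_anti e1 (by linarith)).trans_lt e2,
        hall _ (by linarith), ?_⟩
      have := S.bar (-(2 * k) + 1) (s := T) (t := max T T' + 1) (by push_cast; linarith)
        (by linarith)
      push_cast at this; linarith

lemma total (S : PSol a p ρ θ) : ∃ k, InA a p ρ θ k ∨ InI a p ρ θ k := by
  by_cases hH : ∀ t, 0 ≤ t → 0 ≤ Hp a p ρ θ t
  · obtain ⟨k, h1, ⟨T, hT, h2⟩, -⟩ := S.decay hH
    exact ⟨k, Or.inr ⟨S.Hp_pos_of_nonneg hH, h1, T, by linarith,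
      by have := h2 T le_rfl; linarith [Real.pi_pos]⟩⟩
  · push Not at hH
    obtain ⟨T', e1, e2⟩ := hH
    have h3 : Hp a p ρ θ (T' + 1) < 0 := (S.Hp_anti e1 (by linarith)).trans_lt e2
    obtain ⟨k, h⟩ := S.exists_quad (by linarith : 0 < T' + 1) h3
    exact ⟨k, Or.inl ⟨T' + 1, by linarith, h3, h⟩⟩

lemma nat_le_of {k l : ℕ} (h : -(l : ℝ) * π < -(k : ℝ) * π + π) : k ≤ l := by
  have hpi := Real.pi_pos
  by_contra hc
  push Not at hc
  have : (l : ℝ) + 1 ≤ k := by exact_mod_cast hc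
  nlinarith

lemma InI.decay' (S : PSol a p ρ θ) {k : ℕ} (h : InI a p ρ θ k) :
    (∃ T, 1 ≤ T ∧ ∀ t, T ≤ t → θ t < -(k : ℝ) * π + π / 4) ∧
      (∀ δ, 0 < δ → ∃ T, 1 ≤ T ∧ ∀ t, T ≤ t → En p t (ρ t) ≤ δ) ∧
      ∃ C, ∀ t, 0 ≤ t → ρ t ≤ C - 2 * a * t := by
  obtain ⟨h1, h2, t, ht, h3⟩ := h
  obtain ⟨l, g1, g2, g3⟩ := S.decay (fun t ht => (h1 t ht).le)
  have e1 : k ≤ l := nat_le_of (by linarith [g1 t ht.le])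
  have e2 : l ≤ k := by
    obtain ⟨T, hT, g⟩ := g2
    exact nat_le_of (by linarith [g T le_rfl, h2 T (by linarith), Real.pi_pos])
  obtain rfl : k = l := le_antisymm e1 e2
  exact ⟨g2, g3⟩

lemma InI.unique (S : PSol a p ρ θ) {k l : ℕ} (h : InI a p ρ θ k) (h' : InI a p ρ θ l) :
    k = l := by
  obtain ⟨h1, h2, t, ht, h3⟩ := h
  obtain ⟨g1, g2, s, hs, g3⟩ := h'
  exact le_antisymm (nat_le_of (by linarith [g2 t ht.le])) (nat_le_of (by linarith [h2 s hs.le]))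

lemma InA.later (S : PSol a p ρ θ) {k : ℕ} (h : InA a p ρ θ k) :
    ∃ T, 0 < T ∧ ∀ t, T ≤ t → Hp a p ρ θ t < 0 ∧
      -(k : ℝ) * π < θ t ∧ θ t < -(k : ℝ) * π + π / 2 := by
  obtain ⟨T, hT, h1, h2, h3⟩ := h
  refine ⟨T, hT, fun t ht => ⟨(S.Hp_anti hT.le ht).trans_lt h1, ?_⟩⟩
  have := S.quad hT.le h1 (-(k : ℤ)) (by push_cast; linarith) (by push_cast; linarith) ht
  push_cast at this
  exact this

lemma InA.unique (S : PSol a p ρ θ) {k l : ℕ} (h : InA a p ρ θ k) (h' : InA a p ρ θ l) :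
    k = l := by
  obtain ⟨T, hT, h1⟩ := InA.later S h
  obtain ⟨T', hT', h2⟩ := InA.later S h'
  obtain ⟨-, a1, a2⟩ := h1 (max T T') (le_max_left _ _)
  obtain ⟨-, b1, b2⟩ := h2 (max T T') (le_max_right _ _)
  have := Real.pi_pos
  exact le_antisymm (nat_le_of (by linarith)) (nat_le_of (by linarith))

lemma not_InA_InI (k l : ℕ) (h : InA a p ρ θ k) (h' : InI a p ρ θ l) : False := by
  obtain ⟨T, hT, h1, -⟩ := h
  linarith [h'.1 T hT.le]

/-- Low angle forces many sign changes. -/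
lemma low_angle (S : PSol a p ρ θ) {k j : ℕ} (hj : j ≤ k) {t : ℝ} (ht : 0 ≤ t)
    (h : θ t ≤ -(k : ℝ) * π) : ¬ (InA a p ρ θ j ∨ InI a p ρ θ j) := by
  have hpi := Real.pi_pos
  have h0 : θ t ≤ -(j : ℝ) * π := by
    have : (j : ℝ) ≤ k := by exact_mod_cast hj
    nlinarith
  rintro (hA | hI)
  · obtain ⟨T, hT, h1⟩ := InA.later S hA
    obtain ⟨-, a1, a2⟩ := h1 (max T t + 1) (by linarith [le_max_left T t])
    linarith [S.bark j h0 (by linarith [le_max_right T t] : t < max T t + 1)]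
  · linarith [hI.2.1 t ht]

end PSol

lemma large_low (a p : ℝ) (hp : 0 < p) (k : ℕ) : ∃ M : ℝ, ∀ ρ θ, PSol a p ρ θ → M ≤ ρ 0 →
    θ 1 ≤ -(k : ℝ) * π := by
  have hpi := Real.pi_pos
  refine ⟨2 * a + 1 + (k * π + π / 4 + a) / p, fun ρ θ S hM => ?_⟩
  have h1 := sub_le_of_der (c := a - p * (ρ 0 - 2 * a - 1)) zero_le_one S.dth (fun x e1 e2 => by
    have f1 := (S.rho_lip e1).2
    have f2 := PSol.lc_le e1
    have f3 : p * (ρ 0 - 2 * a - 1) ≤ En p x (ρ x) := by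
      refine le_trans ?_ (Real.add_one_le_exp _ |>.trans' (le_add_of_nonneg_right zero_le_one))
      apply mul_le_mul_of_nonneg_left _ hp.le
      nlinarith [S.ha]
    have f4 : a * Real.sin (2 * θ x) ≤ a := by nlinarith [Real.sin_le_one (2 * θ x), S.ha]
    linarith)
  rw [S.th0] at h1
  have h2 : (k * π + π / 4 + a) / p ≤ ρ 0 - 2 * a - 1 := by linarith
  rw [div_le_iff₀ hp] at h2
  linarith

lemma small_A (a p : ℝ) (ha : 1 / 2 ≤ a) (hp : 0 < p) : ∃ M : ℝ, ∀ ρ θ, PSol a p ρ θ → ρ 0 ≤ M →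
    InA a p ρ θ 0 := by
  have hpi := Real.pi_pos
  refine ⟨Real.log a / p, fun ρ θ S hM => ?_⟩
  have h0 : Hp a p ρ θ 0 < 0 := by
    rw [PSol.hh_neg_iff]
    unfold hh En
    rw [S.th0, lc_zero, show 2 * (π / 4) = π / 2 by ring, Real.sin_pi_div_two, sub_zero, mul_one]
    rw [le_div_iff₀ hp] at hM
    have h1 : Real.exp (p * ρ 0) ≤ a := by
      rw [← Real.le_log_iff_exp_le (by linarith)]; linarith
    have h2 : Real.exp (p * ρ 0) / (p + 1) < Real.exp (p * ρ 0) :=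
      div_lt_self (Real.exp_pos _) (by linarith)
    linarith
  have h1 := S.quad le_rfl h0 0 (by rw [S.th0]; simp; positivity)
    (by rw [S.th0]; simp; linarith) zero_le_one
  refine ⟨1, one_pos, (S.Hp_anti le_rfl zero_le_one).trans_lt h0, ?_⟩
  simpa using h1

/-! ### ODE theory for the polar system -/

def Xf (a p : ℝ) (t : ℝ) (x : ℝ × ℝ) : ℝ × ℝ :=
  (-(2 * a) * Real.cos (2 * x.2), a * Real.sin (2 * x.2) - En p t x.1)

def Xt (a p R : ℝ) (t : ℝ) (x : ℝ × ℝ) : ℝ × ℝ := Xf a p t (min x.1 R, x.2)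

lemma En_lip {p t x y R : ℝ} (hp : 0 < p) (hxy : x ≤ y) (hy : y ≤ R) :
    |En p t x - En p t y| ≤ p * Real.exp (p * R) * (y - x) := by
  unfold En
  have h1 : Real.exp (p * (x - lc t)) ≤ Real.exp (p * (y - lc t)) :=
    Real.exp_le_exp.2 (mul_le_mul_of_nonneg_left (by linarith) hp.le)
  rw [abs_sub_comm, abs_of_nonneg (by linarith)]
  have h2 : Real.exp (p * (x - lc t)) = Real.exp (p * (y - lc t)) * Real.exp (-(p * (y - x))) := by
    rw [← Real.exp_add]; congr 1; ring
  have h3 := Real.add_one_le_exp (-(p * (y - x)))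
  have h4 : Real.exp (p * (y - lc t)) ≤ Real.exp (p * R) :=
    Real.exp_le_exp.2 (mul_le_mul_of_nonneg_left (by linarith [lc_nonneg t]) hp.le)
  have h5 := Real.exp_pos (p * (y - lc t))
  have h6 : 0 ≤ p * (y - x) := mul_nonneg hp.le (by linarith)
  rw [h2]
  nlinarith

lemma En_lip' {p t R : ℝ} (hp : 0 < p) (x y : ℝ) :
    |En p t (min x R) - En p t (min y R)| ≤ p * Real.exp (p * R) * |x - y| := by
  have key : ∀ x y : ℝ, x ≤ y →
      |En p t (min x R) - En p t (min y R)| ≤ p * Real.exp (p * R) * |x - y| := by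
    intro x y h
    refine (En_lip hp (min_le_min_right R h) (min_le_right y R)).trans ?_
    refine mul_le_mul_of_nonneg_left ?_ (by positivity)
    rw [abs_sub_comm, abs_of_nonneg (by linarith)]
    rcases le_total y R with h1 | h1
    · rw [min_eq_left h1, min_eq_left (h.trans h1)]
    · rw [min_eq_right h1]
      rcases le_total x R with h2 | h2
      · rw [min_eq_left h2]; linarith
      · rw [min_eq_right h2]; linarith
  rcases le_total x y with h | h
  · exact key x y h
  · rw [abs_sub_comm, abs_sub_comm x y]; exact key y x h

def KL (a p R : ℝ) : NNReal := Real.toNNReal (4 * a + p * Real.exp (p * R))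

lemma Xt_lip {a p : ℝ} (R : ℝ) (ha : 1 / 2 ≤ a) (hp : 0 < p) (t : ℝ) :
    LipschitzWith (KL a p R) (Xt a p R t) := by
  apply LipschitzWith.of_dist_le_mul
  intro x y
  have hK : ((KL a p R : NNReal) : ℝ) = 4 * a + p * Real.exp (p * R) :=
    Real.coe_toNNReal _ (by positivity)
  rw [hK, Prod.dist_eq, Prod.dist_eq, Real.dist_eq, Real.dist_eq, Real.dist_eq, Real.dist_eq]
  have e1 := Real.abs_cos_sub_cos_le (x := 2 * x.2) (y := 2 * y.2)
  have e2 := Real.abs_sin_sub_sin_le (x := 2 * x.2) (y := 2 * y.2)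
  have e3 := En_lip' (t := t) (R := R) hp x.1 y.1
  have e4 : |2 * x.2 - 2 * y.2| = 2 * |x.2 - y.2| := by
    rw [← mul_sub, abs_mul]; norm_num
  rw [e4] at e1 e2
  set M := max |x.1 - y.1| |x.2 - y.2| with hM
  have m1 : |x.1 - y.1| ≤ M := le_max_left _ _
  have m2 : |x.2 - y.2| ≤ M := le_max_right _ _
  have m0 : 0 ≤ M := (abs_nonneg _).trans m1
  have q0 : 0 < p * Real.exp (p * R) := by positivity
  apply max_le
  · simp only [Xt, Xf]
    rw [← mul_sub, abs_mul, abs_neg, abs_of_nonneg (by linarith : (0:ℝ) ≤ 2 * a)]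
    nlinarith [mul_nonneg q0.le m0]
  · simp only [Xt, Xf]
    have : |a * Real.sin (2 * x.2) - En p t (min x.1 R) - (a * Real.sin (2 * y.2)
        - En p t (min y.1 R))| ≤ a * |Real.sin (2 * x.2) - Real.sin (2 * y.2)|
        + |En p t (min x.1 R) - En p t (min y.1 R)| := by
      rw [show a * Real.sin (2 * x.2) - En p t (min x.1 R) - (a * Real.sin (2 * y.2)
        - En p t (min y.1 R)) = a * (Real.sin (2 * x.2) - Real.sin (2 * y.2)) -
        (En p t (min x.1 R) - En p t (min y.1 R)) by ring]
      refine (abs_sub _ _).trans ?_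
      rw [abs_mul, abs_of_nonneg (by linarith : (0:ℝ) ≤ a)]
    nlinarith [mul_le_mul_of_nonneg_left m1 q0.le]

lemma Xt_bound {a p : ℝ} (R : ℝ) (ha : 1 / 2 ≤ a) (hp : 0 < p) (t : ℝ) (x : ℝ × ℝ) :
    ‖Xt a p R t x‖ ≤ 2 * a + Real.exp (p * R) := by
  rw [Prod.norm_def, Real.norm_eq_abs, Real.norm_eq_abs]
  have h1 := Real.abs_cos_le_one (2 * x.2)
  have h2 := Real.abs_sin_le_one (2 * x.2)
  have h0 := Real.exp_pos (p * R)
  apply max_le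
  · simp only [Xt, Xf]
    rw [abs_mul, abs_neg, abs_of_nonneg (by linarith : (0:ℝ) ≤ 2 * a)]
    nlinarith
  · simp only [Xt, Xf]
    refine (abs_sub _ _).trans ?_
    rw [abs_mul, abs_of_nonneg (by linarith : (0:ℝ) ≤ a), abs_of_pos (En_pos _ _ _)]
    have h4 : En p t (min x.1 R) ≤ Real.exp (p * R) :=
      Real.exp_le_exp.2 (mul_le_mul_of_nonneg_left
        (by linarith [lc_nonneg t, min_le_right x.1 R]) hp.le)
    nlinarith

lemma hd_fst {γ : ℝ → ℝ × ℝ} {γ' : ℝ × ℝ} {t : ℝ} (h : HasDerivAt γ γ' t) :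
    HasDerivAt (fun s => (γ s).1) γ'.1 t :=
  (ContinuousLinearMap.fst ℝ ℝ ℝ).hasFDerivAt.comp_hasDerivAt t h

lemma hd_snd {γ : ℝ → ℝ × ℝ} {γ' : ℝ × ℝ} {t : ℝ} (h : HasDerivAt γ γ' t) :
    HasDerivAt (fun s => (γ s).2) γ'.2 t :=
  (ContinuousLinearMap.snd ℝ ℝ ℝ).hasFDerivAt.comp_hasDerivAt t h

/-- first component grows at most linearly -/
lemma fst_growth {a N : ℝ} (ha : 1 / 2 ≤ a) {x : ℝ → ℝ} {y : ℝ → ℝ}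
    (h : ∀ t ∈ Ioo (-N) N, HasDerivAt x (-(2 * a) * Real.cos (2 * y t)) t) (t : ℝ)
    (ht : t ∈ Ioo (-N) N) : x t ≤ x 0 + 2 * a * N := by
  have hN : 0 < N := by linarith [ht.1, ht.2]
  have := (convex_Ioo (-N) N).norm_image_sub_le_of_norm_hasDerivWithin_le (C := 2 * a)
    (f := x) (fun s hs => (h s hs).hasDerivWithinAt) (fun s _ => by
      rw [Real.norm_eq_abs, abs_mul, abs_neg, abs_of_nonneg (by linarith : (0:ℝ) ≤ 2 * a)]
      have := Real.abs_cos_le_one (2 * y s)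
      nlinarith) (⟨by linarith, hN⟩ : (0:ℝ) ∈ Ioo (-N) N) ht
  rw [Real.norm_eq_abs, Real.norm_eq_abs, sub_zero] at this
  have h2 : |t| ≤ N := abs_le.2 ⟨ht.1.le, ht.2.le⟩
  have h3 := le_abs_self (x t - x 0)
  nlinarith

lemma loc_unique {a p N : ℝ} (ha : 1 / 2 ≤ a) (hp : 0 < p) {γ η : ℝ → ℝ × ℝ} (hN : 0 < N)
    (hγ : ∀ t ∈ Ioo (-N) N, HasDerivAt γ (Xf a p t (γ t)) t)
    (hη : ∀ t ∈ Ioo (-N) N, HasDerivAt η (Xf a p t (η t)) t) (h0 : γ 0 = η 0) :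
    EqOn γ η (Ioo (-N) N) := by
  have key : ∀ ζ : ℝ → ℝ × ℝ, (∀ t ∈ Ioo (-N) N, HasDerivAt ζ (Xf a p t (ζ t)) t) →
      ∀ t ∈ Ioo (-N) N, HasDerivAt ζ (Xt a p ((ζ 0).1 + 2 * a * N) t (ζ t)) t := by
    intro ζ hζ t ht
    refine (hζ t ht).congr_deriv ?_
    unfold Xt
    rw [min_eq_left]
    exact fst_growth ha (fun s hs => hd_fst (hζ s hs)) t ht
  have h1 := key γ hγ
  have h2 := key η hη
  rw [← h0] at h2
  exact ODE_solution_unique_of_mem_Ioo (s := fun _ => univ)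
    (fun t _ => (Xt_lip ((γ 0).1 + 2 * a * N) ha hp t).lipschitzOnWith)
    (⟨by linarith, hN⟩ : (0:ℝ) ∈ Ioo (-N) N) (fun t ht => ⟨h1 t ht, trivial⟩)
    (fun t ht => ⟨h2 t ht, trivial⟩) h0

lemma loc_exists {a p : ℝ} (ha : 1 / 2 ≤ a) (hp : 0 < p) (x0 : ℝ × ℝ) {N : ℝ} (hN : 0 < N) :
    ∃ γ : ℝ → ℝ × ℝ, γ 0 = x0 ∧ ∀ t ∈ Ioo (-N) N, HasDerivAt γ (Xf a p t (γ t)) t := by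
  set R := x0.1 + 2 * a * N with hR
  set Lr : NNReal := Real.toNNReal (2 * a + Real.exp (p * R)) with hL
  have hLr : (Lr : ℝ) = 2 * a + Real.exp (p * R) := Real.coe_toNNReal _ (by positivity)
  set Nn : NNReal := Real.toNNReal N with hNn
  have hNr : (Nn : ℝ) = N := Real.coe_toNNReal _ hN.le
  have hPL : IsPicardLindelof (Xt a p R) (tmin := -N) (tmax := N) ⟨0, by constructor <;> linarith⟩
      x0 (Lr * Nn) 0 Lr (KL a p R) := by
    refine ⟨fun t _ => (Xt_lip R ha hp t).lipschitzOnWith, fun x _ => ?_, fun t _ x _ => ?_, ?_⟩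
    · unfold Xt Xf En
      have := lc_cont
      fun_prop
    · rw [hLr]; exact Xt_bound R ha hp t x
    · simp [hNr]
  obtain ⟨γ, h0, hγ⟩ := hPL.exists_eq_forall_mem_Icc_hasDerivWithinAt₀
  have h1 : ∀ t ∈ Ioo (-N) N, HasDerivAt γ (Xt a p R t (γ t)) t := fun t ht =>
    (hγ t ⟨ht.1.le, ht.2.le⟩).hasDerivAt (Icc_mem_nhds ht.1 ht.2)
  have h00 : γ 0 = x0 := h0
  refine ⟨γ, h00, fun t ht => (h1 t ht).congr_deriv ?_⟩
  have := fst_growth (x := fun s => (γ s).1) (y := fun s => (γ s).2) ha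
    (fun s hs => hd_fst (h1 s hs)) t ht
  unfold Xt
  rw [min_eq_left]
  rw [h00] at this; exact this

lemma glob_exists {a p : ℝ} (ha : 1 / 2 ≤ a) (hp : 0 < p) (x0 : ℝ × ℝ) :
    ∃ γ : ℝ → ℝ × ℝ, γ 0 = x0 ∧ ∀ t, HasDerivAt γ (Xf a p t (γ t)) t := by
  have := fun t : ℝ => loc_exists (N := |t| + 1) ha hp x0 (by positivity)
  choose G hG0 hG using this
  refine ⟨fun t => G t t, hG0 0, fun t => ?_⟩
  have ht : t ∈ Ioo (-(|t| + 1)) (|t| + 1) := by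
    constructor
    · linarith [neg_abs_le t]
    · linarith [le_abs_self t]
  have h1 := hG t t ht
  refine h1.congr_of_eventuallyEq ?_
  filter_upwards [Ioo_mem_nhds ht.1 ht.2] with s hs
  have hs' : |s| < |t| + 1 := abs_lt.2 hs
  set N := min (|t| + 1) (|s| + 1) with hN
  have hNp : 0 < N := lt_min (by positivity) (by positivity)
  refine loc_unique ha hp (N := N) hNp (fun r hr => hG s r ?_) (fun r hr => hG t r ?_)
    (by rw [hG0, hG0]) ?_
  · exact ⟨by linarith [hr.1, min_le_right (|t| + 1) (|s| + 1)],
      by linarith [hr.2, min_le_right (|t| + 1) (|s| + 1)]⟩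
  · exact ⟨by linarith [hr.1, min_le_left (|t| + 1) (|s| + 1)],
      by linarith [hr.2, min_le_left (|t| + 1) (|s| + 1)]⟩
  · have : |s| < N := lt_min hs' (by linarith)
    exact abs_lt.1 this

lemma PSol.pair {a p : ℝ} {ρ θ : ℝ → ℝ} (S : PSol a p ρ θ) (t : ℝ) :
    HasDerivAt (fun s => (ρ s, θ s)) (Xf a p t (ρ t, θ t)) t := (S.dr t).prodMk (S.dth t)

theorem PSol_exists {a p : ℝ} (ha : 1 / 2 ≤ a) (hp : 0 < p) (hp' : p ≤ 1 / 2) (r0 : ℝ) :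
    ∃ ρ θ : ℝ → ℝ, PSol a p ρ θ ∧ ρ 0 = r0 := by
  obtain ⟨γ, h0, h⟩ := glob_exists ha hp (r0, π / 4)
  exact ⟨fun t => (γ t).1, fun t => (γ t).2,
    ⟨fun t => hd_fst (h t), fun t => hd_snd (h t), by simp [h0], ha, hp, hp'⟩, by simp [h0]⟩

theorem PSol_unique {a p : ℝ} {ρ θ ρ' θ' : ℝ → ℝ} (S : PSol a p ρ θ) (S' : PSol a p ρ' θ')
    (h0 : ρ 0 = ρ' 0) (t : ℝ) : ρ t = ρ' t ∧ θ t = θ' t := by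
  have := loc_unique (N := |t| + 1) S.ha S.hp (by positivity) (fun s _ => S.pair s)
    (fun s _ => S'.pair s) (by simp [h0, S.th0, S'.th0]) (abs_lt.1 (by linarith) :
      t ∈ Ioo (-(|t| + 1)) (|t| + 1))
  simpa using this

theorem PSol_symm {a p : ℝ} {ρ θ : ℝ → ℝ} (S : PSol a p ρ θ) (t : ℝ) :
    ρ (-t) = ρ t ∧ θ (-t) = π / 2 - θ t := by
  have hS : PSol a p (fun t => ρ (-t)) (fun t => π / 2 - θ (-t)) := by
    refine ⟨fun t => ?_, fun t => ?_, by simp [S.th0]; ring, S.ha, S.hp, S.hp'⟩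
    · have := (S.dr (-t)).scomp t (hasDerivAt_neg t)
      refine this.congr_deriv ?_
      rw [show 2 * (π / 2 - θ (-t)) = π - 2 * θ (-t) by ring, Real.cos_pi_sub]
      simp
    · have := ((S.dth (-t)).scomp t (hasDerivAt_neg t)).const_sub (π / 2)
      refine this.congr_deriv ?_
      rw [show 2 * (π / 2 - θ (-t)) = π - 2 * θ (-t) by ring, Real.sin_pi_sub]
      simp [En, lc_neg]
  have := PSol_unique hS S (by simp) t
  exact ⟨this.1, by linarith [this.2]⟩

/-- continuous dependence on the initial value, at a fixed positive time -/
theorem PSol_cont {a p : ℝ} {ρ θ : ℝ → ℝ} (S : PSol a p ρ θ) {T : ℝ} (hT : 0 ≤ T) {ε : ℝ}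
    (hε : 0 < ε) : ∃ δ > 0, ∀ ρ' θ' : ℝ → ℝ, PSol a p ρ' θ' → |ρ' 0 - ρ 0| < δ →
      |ρ' T - ρ T| < ε ∧ |θ' T - θ T| < ε := by
  set R := ρ 0 + 1 + 2 * a * (T + 1) with hR
  set K := KL a p R with hK
  have hE := Real.exp_pos (K * (T - 0))
  refine ⟨min 1 (ε / 2 / Real.exp (K * (T - 0))), by positivity, fun ρ' θ' S' hd => ?_⟩
  have hd1 := hd.trans_le (min_le_left _ _)
  have hd2 := hd.le.trans (min_le_right _ _)
  have key : ∀ ρ₁ θ₁ : ℝ → ℝ, PSol a p ρ₁ θ₁ → ρ₁ 0 ≤ ρ 0 + 1 → ∀ t ∈ Ico 0 T,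
      HasDerivWithinAt (fun s => (ρ₁ s, θ₁ s)) (Xt a p R t (ρ₁ t, θ₁ t)) (Ici t) t := by
    intro ρ₁ θ₁ S₁ h1 t ht
    refine ((S₁.pair t).congr_deriv ?_).hasDerivWithinAt
    have := fst_growth (N := T + 1) S.ha (fun s _ => S₁.dr s) t
      ⟨by linarith [ht.1], by linarith [ht.2]⟩
    unfold Xt
    rw [min_eq_left]
    simp only; linarith
  have hc : ∀ ρ₁ θ₁ : ℝ → ℝ, PSol a p ρ₁ θ₁ → ContinuousOn (fun s => (ρ₁ s, θ₁ s)) (Icc 0 T) :=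
    fun ρ₁ θ₁ S₁ t _ => (S₁.pair t).continuousAt.continuousWithinAt
  have := dist_le_of_trajectories_ODE (δ := ε / 2 / Real.exp (K * (T - 0)))
    (fun t => Xt_lip R S.ha S.hp t) (hc _ _ S')
    (key _ _ S' (by linarith [(abs_lt.1 hd1).2])) (hc _ _ S) (key _ _ S (by linarith))
    (by rw [Prod.dist_eq, Real.dist_eq, Real.dist_eq, S.th0, S'.th0, sub_self, abs_zero]
        exact max_le hd2 (by positivity)) T ⟨hT, le_rfl⟩
  rw [← hK, div_mul_cancel₀ _ hE.ne', Prod.dist_eq, Real.dist_eq, Real.dist_eq] at this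
  exact ⟨by linarith [le_max_left |ρ' T - ρ T| |θ' T - θ T|],
    by linarith [le_max_right |ρ' T - ρ T| |θ' T - θ T|]⟩

/-! ### Conversion between polar and cartesian form -/

def uu (ρ θ : ℝ → ℝ) (t : ℝ) : ℝ := Real.exp (ρ t / 2) * Real.cos (θ t)
def vv (ρ θ : ℝ → ℝ) (t : ℝ) : ℝ := Real.exp (ρ t / 2) * Real.sin (θ t)

lemma uv_sq (ρ θ : ℝ → ℝ) (t : ℝ) : uu ρ θ t ^ 2 + vv ρ θ t ^ 2 = Real.exp (ρ t) := by
  unfold uu vv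
  rw [mul_pow, mul_pow, ← mul_add, Real.cos_sq_add_sin_sq, mul_one, ← Real.exp_nat_mul]
  congr 1; push_cast; ring

def am (m : ℕ) : ℝ := ((m : ℝ) - 2) / 2
def pm (m : ℕ) : ℝ := 1 / ((m : ℝ) - 1)

lemma am_ge {m : ℕ} (hm : 3 ≤ m) : 1 / 2 ≤ am m := by
  have : (3 : ℝ) ≤ m := by exact_mod_cast hm
  unfold am; linarith

lemma pm_pos {m : ℕ} (hm : 3 ≤ m) : 0 < pm m := by
  have : (3 : ℝ) ≤ m := by exact_mod_cast hm
  unfold pm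
  exact div_pos one_pos (by linarith)

lemma pm_le {m : ℕ} (hm : 3 ≤ m) : pm m ≤ 1 / 2 := by
  have : (3 : ℝ) ≤ m := by exact_mod_cast hm
  unfold pm
  exact one_div_le_one_div_of_le (by norm_num) (by linarith)

lemma nonlin_eq (m : ℕ) (t x : ℝ) :
    Real.cosh t ^ (-(1 : ℝ) / ((m : ℝ) - 1)) * (Real.exp x) ^ ((1 : ℝ) / ((m : ℝ) - 1))
      = En (pm m) t x := by
  rw [← exp_lc, ← Real.exp_mul, ← Real.exp_mul, ← Real.exp_add]
  unfold En pm
  congr 1; ring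

lemma sol_of_polar {m : ℕ} {ρ θ : ℝ → ℝ} (S : PSol (am m) (pm m) ρ θ) :
    IsSolS2 m (uu ρ θ) (vv ρ θ) := by
  intro t
  rw [uv_sq, nonlin_eq]
  have e1 : HasDerivAt (fun s => Real.exp (ρ s / 2))
      (Real.exp (ρ t / 2) * (-(2 * am m) * Real.cos (2 * θ t) / 2)) t := ((S.dr t).div_const 2).exp
  have e2 := (S.dth t).cos
  have e3 := (S.dth t).sin
  have c2 := Real.cos_two_mul (θ t)
  have s2 := Real.sin_two_mul (θ t)
  have cs := Real.sin_sq_add_cos_sq (θ t)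
  constructor
  · refine (e1.mul e2).congr_deriv ?_
    unfold uu vv
    rw [show ((m : ℝ) - 2) / 2 = am m from rfl, c2, s2]
    linear_combination (-2 * am m * Real.exp (ρ t / 2) * Real.cos (θ t)) * cs
  · refine (e1.mul e3).congr_deriv ?_
    unfold uu vv
    rw [show ((m : ℝ) - 2) / 2 = am m from rfl, c2, s2]
    ring

lemma H2_polar {m : ℕ} (hm : 3 ≤ m) (ρ θ : ℝ → ℝ) (t : ℝ) :
    H2 m t (uu ρ θ t) (vv ρ θ t) = Hp (am m) (pm m) ρ θ t := by
  have h3 : (3 : ℝ) ≤ m := by exact_mod_cast hm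
  unfold H2
  rw [uv_sq]
  have e1 : (m : ℝ) / ((m : ℝ) - 1) = 1 / ((m : ℝ) - 1) + 1 := by
    field_simp [show (m : ℝ) - 1 ≠ 0 by linarith]; ring
  rw [e1, Real.rpow_add (Real.exp_pos _), Real.rpow_one, mul_assoc (((m : ℝ) - 1) / (2 * m)),
    ← mul_assoc (Real.cosh t ^ _), nonlin_eq]
  have e2 : ((m : ℝ) - 1) / (2 * m) = 1 / (2 * (pm m + 1)) := by
    have h1 : (m : ℝ) - 1 ≠ 0 := by linarith
    have h0 : (m : ℝ) ≠ 0 := by linarith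
    have : pm m + 1 = m / ((m : ℝ) - 1) := by rw [e1, pm]
    rw [this]
    field_simp
  have e3 : uu ρ θ t * vv ρ θ t = Real.exp (ρ t) * Real.sin (2 * θ t) / 2 := by
    unfold uu vv
    rw [Real.sin_two_mul, show ρ t = ρ t / 2 + ρ t / 2 by ring, Real.exp_add]
    simp only [add_halves]; ring
  have hpp := pm_pos hm
  rw [mul_assoc (-(((m : ℝ) - 2) / 2)), e3, e2, show ((m : ℝ) - 2) / 2 = am m from rfl]
  unfold Hp hh
  field_simp; ring

lemma polar_of_sol {m : ℕ} (hm : 3 ≤ m) {u v : ℝ → ℝ} (h : IsSolS2 m u v) {μ : ℝ} (hμ : 0 < μ)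
    (hu : u 0 = μ) (hv : v 0 = μ) : ∃ ρ θ : ℝ → ℝ, PSol (am m) (pm m) ρ θ ∧
      ρ 0 = Real.log (2 * μ ^ 2) ∧ u = uu ρ θ ∧ v = vv ρ θ := by
  have ha := am_ge hm
  set a := am m with hadef
  set r : ℝ → ℝ := fun t => u t ^ 2 + v t ^ 2 with hr
  have huc : Continuous u := continuous_iff_continuousAt.2 fun t => (h t).1.continuousAt
  have hvc : Continuous v := continuous_iff_continuousAt.2 fun t => (h t).2.continuousAt
  have dr : ∀ t, HasDerivAt r (2 * a * (v t ^ 2 - u t ^ 2)) t := by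
    intro t
    refine (((h t).1.pow 2).add ((h t).2.pow 2)).congr_deriv ?_
    rw [hadef]; unfold am
    push_cast; ring
  have r0 : r 0 = 2 * μ ^ 2 := by simp only [hr, hu, hv]; ring
  have hrpos : ∀ t, 0 < r t := by
    intro t
    have hr00 : 0 < r 0 := by rw [r0]; positivity
    rcases le_total 0 t with ht | ht
    · have := le_of_der (f := fun s => r s * Real.exp (2 * a * s)) ht
        (fun s => (dr s).mul ((((hasDerivAt_id s).const_mul (2 * a))).exp))
        (fun s _ _ => by
          simp only [id, hr]
          have := Real.exp_pos (2 * a * s)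
          have e : 2 * a * (v s ^ 2 - u s ^ 2) * Real.exp (2 * a * s) + (u s ^ 2 + v s ^ 2) *
            (Real.exp (2 * a * s) * (2 * a * 1)) = 4 * a * v s ^ 2 * Real.exp (2 * a * s) := by ring
          rw [e]; positivity)
      simp only [mul_zero, Real.exp_zero, mul_one] at this
      by_contra hc
      nlinarith [Real.exp_pos (2 * a * t)]
    · have := ge_of_der (f := fun s => r s * Real.exp (-(2 * a) * s)) ht
        (fun s => (dr s).mul ((((hasDerivAt_id s).const_mul (-(2 * a)))).exp))
        (fun s _ _ => by
          simp only [id, hr]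
          have := Real.exp_pos (-(2 * a) * s)
          have e : 2 * a * (v s ^ 2 - u s ^ 2) * Real.exp (-(2 * a) * s) + (u s ^ 2 + v s ^ 2) *
            (Real.exp (-(2 * a) * s) * (-(2 * a) * 1))
              = -(4 * a * u s ^ 2 * Real.exp (-(2 * a) * s)) := by ring
          rw [e]; have : 0 ≤ 4 * a * u s ^ 2 * Real.exp (-(2 * a) * s) := by positivity
          linarith)
      simp only [mul_zero, Real.exp_zero, mul_one] at this
      by_contra hc
      nlinarith [Real.exp_pos (-(2 * a) * t)]
  set ρ : ℝ → ℝ := fun t => Real.log (r t) with hρ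
  have hexp : ∀ t, Real.exp (ρ t) = r t := fun t => Real.exp_log (hrpos t)
  have dρ : ∀ t, HasDerivAt ρ (2 * a * (v t ^ 2 - u t ^ 2) / r t) t :=
    fun t => (dr t).log (hrpos t).ne'
  have hρc : Continuous ρ := continuous_iff_continuousAt.2 fun t => (dρ t).continuousAt
  set g : ℝ → ℝ := fun t => 2 * a * (u t * v t) / r t - En (pm m) t (ρ t) with hg
  have hgc : Continuous g := by
    have hrc : Continuous r := by fun_prop
    have h1 : Continuous fun t => 2 * a * (u t * v t) / r t :=
      Continuous.div (by fun_prop) hrc (fun t => (hrpos t).ne')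
    have h2 : Continuous fun t => En (pm m) t (ρ t) := by
      unfold En; have := lc_cont; fun_prop
    exact h1.sub h2
  set θ : ℝ → ℝ := fun t => π / 4 + ∫ s in (0:ℝ)..t, g s with hθ
  have dθ : ∀ t, HasDerivAt θ (g t) t := fun t =>
    (hgc.integral_hasStrictDerivAt 0 t).hasDerivAt.const_add (π / 4)
  have θ0 : θ 0 = π / 4 := by simp [hθ]
  have du : ∀ t, HasDerivAt u (a * (v t ^ 2 - u t ^ 2) / r t * u t - g t * v t) t := by
    intro t
    refine (h t).1.congr_deriv ?_
    rw [show u t ^ 2 + v t ^ 2 = Real.exp (ρ t) from (hexp t).symm, nonlin_eq,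
      show ((m : ℝ) - 2) / 2 = a from rfl]
    simp only [hg]
    have := (hrpos t).ne'
    field_simp
    simp only [hr]; ring
  have dv : ∀ t, HasDerivAt v (a * (v t ^ 2 - u t ^ 2) / r t * v t + g t * u t) t := by
    intro t
    refine (h t).2.congr_deriv ?_
    rw [show u t ^ 2 + v t ^ 2 = Real.exp (ρ t) from (hexp t).symm, nonlin_eq,
      show ((m : ℝ) - 2) / 2 = a from rfl]
    simp only [hg]
    have := (hrpos t).ne'
    field_simp
    simp only [hr]; ring
  have de : ∀ t, HasDerivAt (fun s => Real.exp (-(ρ s / 2)))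
      (Real.exp (-(ρ t / 2)) * (-(2 * a * (v t ^ 2 - u t ^ 2) / r t / 2))) t :=
    fun t => (((dρ t).div_const 2).neg).exp
  have k1 : ∀ t, (u t * Real.cos (θ t) + v t * Real.sin (θ t)) * Real.exp (-(ρ t / 2))
      = (u 0 * Real.cos (θ 0) + v 0 * Real.sin (θ 0)) * Real.exp (-(ρ 0 / 2)) := by
    have hd : ∀ t, HasDerivAt
        (fun t => (u t * Real.cos (θ t) + v t * Real.sin (θ t)) * Real.exp (-(ρ t / 2))) 0 t := by
      intro t
      refine ((((du t).mul (dθ t).cos).add ((dv t).mul (dθ t).sin)).mul (de t)).congr_deriv ?_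
      simp only [Pi.add_apply, Pi.mul_apply]
      ring
    intro t
    exact is_const_of_deriv_eq_zero (fun t => (hd t).differentiableAt) (fun t => (hd t).deriv) t 0
  have k2 : ∀ t, (v t * Real.cos (θ t) - u t * Real.sin (θ t)) * Real.exp (-(ρ t / 2))
      = (v 0 * Real.cos (θ 0) - u 0 * Real.sin (θ 0)) * Real.exp (-(ρ 0 / 2)) := by
    have hd : ∀ t, HasDerivAt
        (fun t => (v t * Real.cos (θ t) - u t * Real.sin (θ t)) * Real.exp (-(ρ t / 2))) 0 t := by
      intro t
      refine ((((dv t).mul (dθ t).cos).sub ((du t).mul (dθ t).sin)).mul (de t)).congr_deriv ?_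
      simp only [Pi.sub_apply, Pi.mul_apply]
      ring
    intro t
    exact is_const_of_deriv_eq_zero (fun t => (hd t).differentiableAt) (fun t => (hd t).deriv) t 0
  have hs2 : Real.sqrt 2 * Real.sqrt 2 = 2 := Real.mul_self_sqrt (by norm_num)
  have hs2p : 0 < Real.sqrt 2 := Real.sqrt_pos.2 (by norm_num)
  have hρ0 : Real.exp (ρ 0 / 2) = Real.sqrt 2 * μ := by
    have e1 : Real.exp (ρ 0 / 2) ^ 2 = (Real.sqrt 2 * μ) ^ 2 := by
      rw [← Real.exp_nat_mul, show ((2 : ℕ) : ℝ) * (ρ 0 / 2) = ρ 0 by push_cast; ring, hexp, r0,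
        mul_pow, sq (Real.sqrt 2), hs2]
    exact (pow_left_inj₀ (Real.exp_pos _).le (by positivity) two_ne_zero).1 e1
  have k1' : ∀ t, u t * Real.cos (θ t) + v t * Real.sin (θ t) = Real.exp (ρ t / 2) := by
    intro t
    have := k1 t
    rw [hu, hv, θ0, Real.cos_pi_div_four, Real.sin_pi_div_four, Real.exp_neg, Real.exp_neg,
      hρ0] at this
    have e := Real.exp_pos (ρ t / 2)
    rw [← div_eq_mul_inv, ← div_eq_mul_inv, div_eq_iff e.ne'] at this
    rw [this]
    have : (μ * (Real.sqrt 2 / 2) + μ * (Real.sqrt 2 / 2)) / (Real.sqrt 2 * μ) = 1 := by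
      field_simp; norm_num
    rw [this, one_mul]
  have k2' : ∀ t, v t * Real.cos (θ t) - u t * Real.sin (θ t) = 0 := by
    intro t
    have := k2 t
    rw [hu, hv, θ0, Real.cos_pi_div_four, Real.sin_pi_div_four, sub_self, zero_mul] at this
    exact (mul_eq_zero.1 this).resolve_right (Real.exp_pos _).ne'
  have hu' : ∀ t, u t = uu ρ θ t := by
    intro t
    unfold uu
    linear_combination Real.cos (θ t) * k1' t - Real.sin (θ t) * k2' t
      - u t * Real.sin_sq_add_cos_sq (θ t)
  have hv' : ∀ t, v t = vv ρ θ t := by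
    intro t
    unfold vv
    linear_combination Real.sin (θ t) * k1' t + Real.cos (θ t) * k2' t
      - v t * Real.sin_sq_add_cos_sq (θ t)
  have hee : ∀ t, r t = Real.exp (ρ t / 2) * Real.exp (ρ t / 2) := by
    intro t; rw [← hexp, ← Real.exp_add, add_halves]
  refine ⟨ρ, θ, ⟨fun t => (dρ t).congr_deriv ?_, fun t => (dθ t).congr_deriv ?_, θ0, ha,
    pm_pos hm, pm_le hm⟩, by simp only [hρ]; rw [r0], funext hu', funext hv'⟩
  · rw [hu', hv', hee, Real.cos_two_mul']
    unfold uu vv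
    field_simp; ring
  · simp only [hg]
    rw [hu', hv', hee, Real.sin_two_mul]
    unfold uu vv
    field_simp

/-! ### Counting sign changes, and membership in the sets -/

namespace PSol

variable {a p : ℝ} {ρ θ : ℝ → ℝ}

lemma barpi (S : PSol a p ρ θ) (k : ℕ) {s t : ℝ} (h0 : θ s ≤ π - (k : ℝ) * π) (hst : s < t) :
    θ t < π - (k : ℝ) * π := by
  have := S.bar (2 - 2 * (k : ℤ)) (s := s) (t := t) (by push_cast; linarith) hst
  push_cast at this; linarith

lemma sin_nat (x : ℝ) (n : ℕ) : Real.sin x = (-1) ^ n * Real.sin (x + n * π) := by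
  rw [Real.sin_add_nat_mul_pi, ← mul_assoc, ← mul_pow]; simp

lemma changes_iff (S : PSol a p ρ θ) (k : ℕ) :
    ChangesSignAtLeast (vv ρ θ) (Ioi 0) k ↔ ∃ t, 0 < t ∧ θ t < π - (k : ℝ) * π := by
  have hpi := Real.pi_pos
  have hsgn : ∀ s t, vv ρ θ s * vv ρ θ t < 0 ↔ Real.sin (θ s) * Real.sin (θ t) < 0 := by
    intro s t
    unfold vv
    rw [show Real.exp (ρ s / 2) * Real.sin (θ s) * (Real.exp (ρ t / 2) * Real.sin (θ t)) =
      (Real.exp (ρ s / 2) * Real.exp (ρ t / 2)) * (Real.sin (θ s) * Real.sin (θ t)) by ring]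
    rw [mul_neg_iff]
    have : 0 < Real.exp (ρ s / 2) * Real.exp (ρ t / 2) := by positivity
    constructor
    · rintro (h | h)
      · exact h.2
      · linarith [h.1]
    · intro h; exact Or.inl ⟨this, h⟩
  constructor
  · rintro ⟨s, hs, hlt, hw⟩
    have key : ∀ i, i ≤ k → θ (s i) < π - (i : ℝ) * π := by
      intro i
      induction i with
      | zero =>
        intro h
        have := S.bar 1 (s := 0) (t := s 0) (by rw [S.th0]; push_cast; linarith) (hs 0 h)
        push_cast at this ⊢; linarith
      | succ i ih =>
        intro h
        have h1 := ih (by omega)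
        have h2 := hlt i (i + 1) (by omega) h
        have h3 := (hsgn _ _).1 (hw i h)
        by_contra hc
        push_cast at hc
        have h4 : -(i : ℝ) * π < θ (s i) := by
          by_contra hc'
          have := S.bark i (not_lt.1 hc') h2
          linarith
        have h5 := S.barpi i h1.le h2
        have a1 : 0 ≤ Real.sin (θ (s i) + i * π) :=
          Real.sin_nonneg_of_nonneg_of_le_pi (by linarith) (by linarith)
        have a2 : 0 ≤ Real.sin (θ (s (i + 1)) + i * π) :=
          Real.sin_nonneg_of_nonneg_of_le_pi (by linarith) (by linarith)
        rw [sin_nat (θ (s i)) i, sin_nat (θ (s (i + 1))) i, mul_mul_mul_comm, ← mul_pow] at h3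
        norm_num at h3
        nlinarith [mul_nonneg a1 a2]
    exact ⟨s k, hs k le_rfl, key k le_rfl⟩
  · rintro ⟨t, ht, h⟩
    have hex : ∀ i : ℕ, ∃ x, i ≤ k → 0 < x ∧ -(i : ℝ) * π < θ x ∧ θ x < π - (i : ℝ) * π := by
      intro i
      by_cases hik : i ≤ k
      · have hik' : (i : ℝ) ≤ k := by exact_mod_cast hik
        have hm := mul_le_mul_of_nonneg_right hik' hpi.le
        by_cases hlow : -(i : ℝ) * π < θ t
        · exact ⟨t, fun _ => ⟨ht, hlow, by linarith⟩⟩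
        · have hi0 : 0 ≤ (i : ℝ) * π := by positivity
          obtain ⟨x, x1, x2, x3⟩ := ivt S.contth ht.le (c := -(i : ℝ) * π + π / 8)
            (by rw [S.th0]; linarith) (by linarith)
          refine ⟨x, fun _ => ⟨lt_of_le_of_ne x1 ?_, by linarith, by linarith⟩⟩
          rintro rfl
          rw [S.th0] at x3; linarith
      · exact ⟨0, fun h => absurd h hik⟩
    choose s hs using hex
    refine ⟨s, fun i hi => (hs i hi).1, fun i j hij hj => ?_, fun i hi => ?_⟩
    · obtain ⟨-, b1, b2⟩ := hs i (by omega)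
      obtain ⟨-, c1, c2⟩ := hs j hj
      have hij' : (i : ℝ) + 1 ≤ j := by exact_mod_cast hij
      have hm := mul_le_mul_of_nonneg_right hij' hpi.le
      by_contra hc
      rcases (not_lt.1 hc).eq_or_lt with he | hl
      · rw [he] at c2; linarith
      · have := S.bark i (s := s j) (t := s i) (by linarith) hl
        linarith
    · obtain ⟨-, b1, b2⟩ := hs i (by omega)
      obtain ⟨-, c1, c2⟩ := hs (i + 1) hi
      push_cast at c1 c2
      rw [hsgn]
      have a1 : 0 < Real.sin (θ (s i) + i * π) :=
        Real.sin_pos_of_pos_of_lt_pi (by linarith) (by linarith)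
      have a2 : 0 < Real.sin (θ (s (i + 1)) + (i + 1 : ℕ) * π) :=
        Real.sin_pos_of_pos_of_lt_pi (by push_cast; linarith) (by push_cast; linarith)
      rw [sin_nat (θ (s i)) i, sin_nat (θ (s (i + 1))) (i + 1), mul_mul_mul_comm, pow_succ,
        ← mul_assoc ((-1 : ℝ) ^ i) ((-1 : ℝ) ^ i), ← mul_pow]
      have := mul_pos a1 a2
      norm_num at this ⊢
      linarith

lemma exactly_iff (S : PSol a p ρ θ) (k : ℕ) :
    ChangesSignExactly (vv ρ θ) (Ioi 0) k ↔
      (∃ t, 0 < t ∧ θ t < π - (k : ℝ) * π) ∧ ∀ t, 0 ≤ t → -(k : ℝ) * π < θ t := by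
  have hpi := Real.pi_pos
  unfold ChangesSignExactly
  rw [S.changes_iff, S.changes_iff]
  refine and_congr_right fun _ => ?_
  push Not
  push_cast
  constructor
  · intro h t ht
    by_contra hc
    have h1 := S.bark k (not_lt.1 hc) (lt_add_one t)
    have h2 := h (t + 1) (by linarith)
    linarith
  · intro h t ht
    linarith [h t ht.le]

lemma Hp_even (S : PSol a p ρ θ) (t : ℝ) : Hp a p ρ θ (-t) = Hp a p ρ θ t := by
  obtain ⟨h1, h2⟩ := PSol_symm S t
  unfold Hp hh
  rw [h1, h2, show 2 * (π / 2 - θ t) = π - 2 * θ t by ring, Real.sin_pi_sub]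
  simp [En, lc_neg]

lemma InA_iff (S : PSol a p ρ θ) (k : ℕ) : InA a p ρ θ k ↔
    ((∃ t, 0 < t ∧ θ t < π - (k : ℝ) * π) ∧ ∀ t, 0 ≤ t → -(k : ℝ) * π < θ t) ∧
      ∀ T, ∃ t, T ≤ t ∧ Hp a p ρ θ t < 0 := by
  have hpi := Real.pi_pos
  constructor
  · intro h
    obtain ⟨T, hT, hl⟩ := InA.later S h
    refine ⟨⟨⟨T, hT, by linarith [(hl T le_rfl).2.2]⟩, fun t ht => ?_⟩,
      fun T' => ⟨max T T', le_max_right _ _, (hl _ (le_max_left _ _)).1⟩⟩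
    by_contra hc
    have h1 := S.bark k (not_lt.1 hc)
      (by linarith [le_max_right T t] : t < max T t + 1)
    linarith [(hl (max T t + 1) (by linarith [le_max_left T t])).2.1]
  · rintro ⟨⟨⟨t, ht, h1⟩, h2⟩, h3⟩
    obtain ⟨T, hT, hH⟩ := h3 (t + 1)
    have h4 := S.barpi k h1.le (by linarith : t < T)
    refine ⟨T, by linarith, hH, h2 T (by linarith), ?_⟩
    by_contra hc
    have hs := S.sin_pos hH
    have := sin_nonpos_of (x := θ T) (1 - (k : ℤ)) (by push_cast; linarith) (by push_cast; linarith)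
    linarith

lemma neg_limit (S : PSol a p ρ θ) (h : ∃ t, 0 ≤ t ∧ Hp a p ρ θ t < 0) :
    (∃ L : ℝ, L < 0 ∧ Tendsto (Hp a p ρ θ) atTop (𝓝 L) ∧ Tendsto (Hp a p ρ θ) atBot (𝓝 L)) ∨
    (Tendsto (Hp a p ρ θ) atTop atBot ∧ Tendsto (Hp a p ρ θ) atBot atBot) := by
  have hev : Hp a p ρ θ = (Hp a p ρ θ) ∘ Neg.neg := funext fun t => (S.Hp_even t).symm
  have hanti : Antitone fun t => Hp a p ρ θ (max t 0) := fun s t hst =>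
    S.Hp_anti (le_max_right _ _) (max_le_max_right 0 hst)
  have heq : (fun t => Hp a p ρ θ (max t 0)) =ᶠ[atTop] Hp a p ρ θ := by
    filter_upwards [eventually_ge_atTop 0] with t ht
    rw [max_eq_left ht]
  rcases tendsto_atTop_of_antitone hanti with h1 | ⟨L, h1⟩
  · right
    have h2 := h1.congr' heq
    refine ⟨h2, ?_⟩
    rw [hev]
    exact h2.comp tendsto_neg_atBot_atTop
  · left
    have h2 := h1.congr' heq
    refine ⟨L, ?_, h2, ?_⟩
    · obtain ⟨t, ht, hn⟩ := h
      have := hanti.le_of_tendsto h1 t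
      rw [max_eq_left ht] at this
      linarith
    · rw [hev]
      exact h2.comp tendsto_neg_atBot_atTop

end PSol

lemma mem_setA_iff {m k : ℕ} (hm : 3 ≤ m) {μ : ℝ} (hμ : 0 < μ) {ρ θ : ℝ → ℝ}
    (S : PSol (am m) (pm m) ρ θ) (h0 : ρ 0 = Real.log (2 * μ ^ 2)) :
    μ ∈ setA m k ↔ InA (am m) (pm m) ρ θ k := by
  have hH : (fun t => H2 m t (uu ρ θ t) (vv ρ θ t)) = Hp (am m) (pm m) ρ θ :=
    funext fun t => H2_polar hm ρ θ t
  constructor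
  · rintro ⟨-, u, v, hs, hu, hv, hex, hl⟩
    obtain ⟨ρ', θ', S', h0', rfl, rfl⟩ := polar_of_sol hm hs hμ hu hv
    have e1 : ρ' = ρ := funext fun t => (PSol_unique S' S (by rw [h0, h0']) t).1
    have e2 : θ' = θ := funext fun t => (PSol_unique S' S (by rw [h0, h0']) t).2
    subst e1 e2
    rw [S.InA_iff]
    refine ⟨(S.exactly_iff k).1 hex, fun T => ?_⟩
    unfold EnergyNegLimit at hl
    rw [hH] at hl
    have : ∀ᶠ t in atTop, Hp (am m) (pm m) ρ' θ' t < 0 := by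
      rcases hl with ⟨L, hL, h1, -⟩ | ⟨h1, -⟩
      · exact h1.eventually_lt_const hL
      · exact h1.eventually_lt_atBot 0
    obtain ⟨t, h1, h2⟩ := (this.and (eventually_ge_atTop T)).exists
    exact ⟨t, h2, h1⟩
  · intro h
    have h' := (S.InA_iff k).1 h
    obtain ⟨t, ht, hn⟩ := h'.2 0
    obtain ⟨e, c0, s0⟩ : Real.exp (ρ 0 / 2) = Real.sqrt 2 * μ ∧ Real.cos (θ 0) = Real.sqrt 2 / 2
        ∧ Real.sin (θ 0) = Real.sqrt 2 / 2 := by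
      rw [S.th0]
      refine ⟨?_, Real.cos_pi_div_four, Real.sin_pi_div_four⟩
      rw [h0, Real.exp_half, Real.exp_log (by positivity), Real.sqrt_mul (by norm_num),
        Real.sqrt_sq hμ.le]
    have hs2 : Real.sqrt 2 * Real.sqrt 2 = 2 := Real.mul_self_sqrt (by norm_num)
    refine ⟨hμ, uu ρ θ, vv ρ θ, sol_of_polar S, ?_, ?_, (S.exactly_iff k).2 h'.1, ?_⟩
    · unfold uu; rw [e, c0]; linear_combination μ / 2 * hs2
    · unfold vv; rw [e, s0]; linear_combination μ / 2 * hs2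
    · unfold EnergyNegLimit
      rw [hH]
      exact S.neg_limit ⟨t, ht, hn⟩

lemma mem_setI_iff {m k : ℕ} (hm : 3 ≤ m) {μ : ℝ} (hμ : 0 < μ) {ρ θ : ℝ → ℝ}
    (S : PSol (am m) (pm m) ρ θ) (h0 : ρ 0 = Real.log (2 * μ ^ 2)) :
    μ ∈ setI m k ↔ InI (am m) (pm m) ρ θ k := by
  constructor
  · rintro ⟨-, u, v, hs, hu, hv, hex, hl, -⟩
    obtain ⟨ρ', θ', S', h0', rfl, rfl⟩ := polar_of_sol hm hs hμ hu hv
    have e1 : ρ' = ρ := funext fun t => (PSol_unique S' S (by rw [h0, h0']) t).1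
    have e2 : θ' = θ := funext fun t => (PSol_unique S' S (by rw [h0, h0']) t).2
    subst e1 e2
    obtain ⟨⟨t, ht, h1⟩, h2⟩ := (S.exactly_iff k).1 hex
    exact ⟨fun t _ => by rw [← H2_polar hm]; exact hl t, h2, t, ht, by linarith⟩
  · intro h
    obtain ⟨hH, h2, t, ht, h3⟩ := h
    obtain ⟨e, c0, s0⟩ : Real.exp (ρ 0 / 2) = Real.sqrt 2 * μ ∧ Real.cos (θ 0) = Real.sqrt 2 / 2
        ∧ Real.sin (θ 0) = Real.sqrt 2 / 2 := by
      rw [S.th0]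
      refine ⟨?_, Real.cos_pi_div_four, Real.sin_pi_div_four⟩
      rw [h0, Real.exp_half, Real.exp_log (by positivity), Real.sqrt_mul (by norm_num),
        Real.sqrt_sq hμ.le]
    have hs2 : Real.sqrt 2 * Real.sqrt 2 = 2 := Real.mul_self_sqrt (by norm_num)
    refine ⟨hμ, uu ρ θ, vv ρ θ, sol_of_polar S, ?_, ?_,
      (S.exactly_iff k).2 ⟨⟨t, ht, by linarith⟩, h2⟩, fun s => ?_, ?_⟩
    · unfold uu; rw [e, c0]; linear_combination μ / 2 * hs2
    · unfold vv; rw [e, s0]; linear_combination μ / 2 * hs2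
    · rw [H2_polar hm]
      rcases le_total 0 s with hs | hs
      · exact hH s hs
      · rw [← S.Hp_even]; exact hH (-s) (by linarith)
    · obtain ⟨-, -, C, hC⟩ := PSol.InI.decay' S ⟨hH, h2, t, ht, h3⟩
      have hC' : ∀ s, ρ s ≤ C := by
        intro s
        have ha := S.ha
        rcases le_total 0 s with hs | hs
        · nlinarith [hC s hs]
        · rw [← (PSol_symm S s).1]
          nlinarith [hC (-s) (by linarith)]
      refine ⟨Real.exp (C / 2) + Real.exp (C / 2), fun s => ?_⟩
      have hle : Real.exp (ρ s / 2) ≤ Real.exp (C / 2) :=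
        Real.exp_le_exp.2 (by linarith [hC' s])
      have hpos := Real.exp_pos (ρ s / 2)
      unfold uu vv
      rw [abs_mul, abs_mul, abs_of_pos hpos]
      have := Real.abs_cos_le_one (θ s)
      have := Real.abs_sin_le_one (θ s)
      nlinarith

/-! ### Topological argument -/

theorem topo (A I : ℕ → Set ℝ) (hA0 : ∀ k μ, μ ∈ A k → 0 < μ)
    (hcov : ∀ μ, 0 < μ → ∃ k, μ ∈ A k ∨ μ ∈ I k)
    (huniq : ∀ μ k l, (μ ∈ A k ∨ μ ∈ I k) → (μ ∈ A l ∨ μ ∈ I l) → k = l)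
    (hopen : ∀ k, IsOpen (A k))
    (hloc : ∀ k μ, μ ∈ I k → ∀ᶠ x in 𝓝 μ, x ∈ A k ∨ x ∈ I k ∨ x ∈ A (k + 1))
    (hsmall : ∃ δ > 0, ∀ μ, 0 < μ → μ < δ → μ ∈ A 0)
    (hlarge : ∀ k, ∃ M, ∀ μ, M ≤ μ → 0 < μ → ∀ j ≤ k, ¬ (μ ∈ A j ∨ μ ∈ I j))
    (hI0 : ∀ k μ, μ ∈ I k → 0 < μ) :
    (∀ k : ℕ, (A k).Nonempty ∧ BddAbove (A k) ∧ IsOpen (A k)) ∧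
    (∀ k : ℕ, sSup (A k) ∈ I k) ∧
    StrictMono (fun k : ℕ => sSup (A k)) ∧
    Tendsto (fun k : ℕ => sSup (A k)) atTop atTop ∧
    (∀ k : ℕ, BddAbove (I k) ∧
      ∃ ε : ℝ, 0 < ε ∧ Set.Ioo (sSup (I k)) (sSup (I k) + ε) ⊆ A (k + 1)) := by
  obtain ⟨δ, hδ, hsm⟩ := hsmall
  set B : ℕ → Set ℝ := fun k => {μ | ∃ j ≤ k, μ ∈ A j ∨ μ ∈ I j} with hB
  have hAB : ∀ k, A k ⊆ B k := fun k μ h => ⟨k, le_rfl, Or.inl h⟩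
  have hIB : ∀ k, I k ⊆ B k := fun k μ h => ⟨k, le_rfl, Or.inr h⟩
  have hBpos : ∀ k μ, μ ∈ B k → 0 < μ := by
    rintro k μ ⟨j, -, h | h⟩
    · exact hA0 j μ h
    · exact hI0 j μ h
  have hBbdd : ∀ k, BddAbove (B k) := by
    intro k
    obtain ⟨M, hM⟩ := hlarge k
    refine ⟨M, fun μ hμ => ?_⟩
    by_contra hc
    obtain ⟨j, hj, h⟩ := hμ
    exact hM μ (not_le.1 hc).le (hBpos k μ ⟨j, hj, h⟩) j hj h
  have hBne : ∀ k, δ / 2 ∈ B k := fun k =>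
    ⟨0, Nat.zero_le k, Or.inl (hsm _ (by linarith) (by linarith))⟩
  have right : ∀ (x : ℝ) (P : ℝ → Prop), (∀ᶠ y in 𝓝 x, P y) →
      ∃ ε > 0, ∀ y, x < y → y < x + ε → P y := by
    intro x P h
    obtain ⟨ε, hε, hP⟩ := Metric.eventually_nhds_iff.1 h
    refine ⟨ε, hε, fun y h1 h2 => hP ?_⟩
    rw [Real.dist_eq, abs_lt]; constructor <;> linarith
  have left : ∀ (s : Set ℝ) (P : ℝ → Prop), s.Nonempty → BddAbove s →
      (∀ᶠ y in 𝓝 (sSup s), P y) → ∃ y ∈ s, P y := by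
    intro s P hne hb h
    obtain ⟨ε, hε, hP⟩ := Metric.eventually_nhds_iff.1 h
    obtain ⟨y, hy, hlt⟩ := exists_lt_of_lt_csSup hne (sub_lt_self (sSup s) hε)
    refine ⟨y, hy, hP ?_⟩
    have := le_csSup hb hy
    rw [Real.dist_eq, abs_lt]; constructor <;> linarith
  have hν : ∀ k, sSup (B k) ∈ I k ∧ ∃ ε > 0, Ioo (sSup (B k)) (sSup (B k) + ε) ⊆ A (k + 1) := by
    intro k
    set ν := sSup (B k) with hνd
    have hνpos : 0 < ν := by linarith [le_csSup (hBbdd k) (hBne k)]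
    have hnotr : ∀ y, ν < y → y ∉ B k := fun y hy h => by linarith [le_csSup (hBbdd k) h]
    obtain ⟨l, hl | hl⟩ := hcov ν hνpos
    · exfalso
      have hnb : ∀ᶠ y in 𝓝 ν, y ∈ A l := (hopen l).mem_nhds hl
      obtain ⟨y, ⟨j, hj, hy⟩, hyA⟩ := left _ _ ⟨_, hBne k⟩ (hBbdd k) hnb
      have := huniq y j l hy (Or.inl hyA)
      subst this
      obtain ⟨ε, hε, hr⟩ := right ν _ hnb
      exact hnotr (ν + ε / 2) (by linarith)
        ⟨j, hj, Or.inl (hr _ (by linarith) (by linarith))⟩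
    · have hnb := hloc l ν hl
      obtain ⟨ε, hε, hr⟩ := right ν _ hnb
      have hlk : l ≤ k := by
        obtain ⟨y, ⟨j, hj, hy⟩, hyA⟩ := left _ _ ⟨_, hBne k⟩ (hBbdd k) hnb
        rcases hyA with h | h | h
        · have := huniq y j l hy (Or.inl h); omega
        · have := huniq y j l hy (Or.inr h); omega
        · have := huniq y j (l + 1) hy (Or.inl h); omega
      have hkl : k ≤ l := by
        by_contra hc
        apply hnotr (ν + ε / 2) (by linarith)
        rcases hr (ν + ε / 2) (by linarith) (by linarith) with h | h | h
        · exact ⟨l, hlk, Or.inl h⟩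
        · exact ⟨l, hlk, Or.inr h⟩
        · exact ⟨l + 1, by omega, Or.inl h⟩
      have : l = k := le_antisymm hlk hkl
      subst this
      refine ⟨hl, ε, hε, fun y hy => ?_⟩
      rcases hr y hy.1 hy.2 with h | h | h
      · exact absurd (hAB l h) (hnotr y hy.1)
      · exact absurd (hIB l h) (hnotr y hy.1)
      · exact h
  have hνI : ∀ k, sSup (I k) = sSup (B k) := by
    intro k
    exact IsGreatest.csSup_eq ⟨(hν k).1, fun y hy => le_csSup (hBbdd k) (hIB k hy)⟩
  have hAbdd : ∀ k, BddAbove (A k) := fun k => (hBbdd k).mono (hAB k)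
  have hgt : ∀ k, ∃ y ∈ A (k + 1), sSup (B k) < y := by
    intro k
    obtain ⟨-, ε, hε, h⟩ := hν k
    exact ⟨sSup (B k) + ε / 2, h ⟨by linarith, by linarith⟩, by linarith⟩
  have hAne : ∀ k, (A k).Nonempty := by
    intro k
    cases k with
    | zero => exact ⟨δ / 2, hsm _ (by linarith) (by linarith)⟩
    | succ k => obtain ⟨y, hy, -⟩ := hgt k; exact ⟨y, hy⟩
  have hgt' : ∀ k, sSup (B k) < sSup (A (k + 1)) := by
    intro k
    obtain ⟨y, hy, h⟩ := hgt k
    exact h.trans_le (le_csSup (hAbdd _) hy)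
  have hμ : ∀ k, sSup (A k) ∈ I k := by
    intro k
    have hpos : 0 < sSup (A k) := by
      obtain ⟨y, hy⟩ := hAne k
      exact (hA0 k y hy).trans_le (le_csSup (hAbdd k) hy)
    obtain ⟨l, hl | hl⟩ := hcov _ hpos
    · exfalso
      have hnb : ∀ᶠ y in 𝓝 (sSup (A k)), y ∈ A l := (hopen l).mem_nhds hl
      obtain ⟨y, hy, hyA⟩ := left _ _ (hAne k) (hAbdd k) hnb
      have := huniq y k l (Or.inl hy) (Or.inl hyA)
      subst this
      obtain ⟨ε, hε, hr⟩ := right _ _ hnb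
      linarith [le_csSup (hAbdd k) (hr (sSup (A k) + ε / 2) (by linarith) (by linarith))]
    · obtain ⟨y, hy, hyA⟩ := left _ _ (hAne k) (hAbdd k) (hloc l _ hl)
      rcases hyA with h | h | h
      · have := huniq y k l (Or.inl hy) (Or.inl h); rwa [this] at hl ⊢
      · have := huniq y k l (Or.inl hy) (Or.inr h); rwa [this] at hl ⊢
      · have := huniq y k (l + 1) (Or.inl hy) (Or.inl h)
        subst this
        linarith [hgt' l, le_csSup (hBbdd l) (hIB l hl)]
  have hmono : StrictMono (fun k : ℕ => sSup (A k)) :=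
    strictMono_nat_of_lt_succ fun k => (le_csSup (hBbdd k) (hIB k (hμ k))).trans_lt (hgt' k)
  refine ⟨fun k => ⟨hAne k, hAbdd k, hopen k⟩, hμ, hmono, ?_, fun k => ⟨(hBbdd k).mono (hIB k), ?_⟩⟩
  · rcases tendsto_atTop_of_monotone hmono.monotone with h | ⟨c, h⟩
    · exact h
    · exfalso
      have hc : 0 < c := (hI0 0 _ (hμ 0)).trans_le (hmono.monotone.ge_of_tendsto h 0)
      have : ∃ l, ∀ᶠ x in 𝓝 c, ∃ j ≤ l, x ∈ A j ∨ x ∈ I j := by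
        obtain ⟨l, hl | hl⟩ := hcov c hc
        · exact ⟨l, Filter.Eventually.mono ((hopen l).mem_nhds hl)
            fun x hx => ⟨l, le_rfl, Or.inl hx⟩⟩
        · refine ⟨l + 1, (hloc l c hl).mono fun x hx => ?_⟩
          rcases hx with h | h | h
          · exact ⟨l, by omega, Or.inl h⟩
          · exact ⟨l, by omega, Or.inr h⟩
          · exact ⟨l + 1, le_rfl, Or.inl h⟩
      obtain ⟨l, hl⟩ := this
      obtain ⟨k, ⟨j, hj, hk⟩, hkl⟩ := ((h.eventually hl).and (eventually_gt_atTop l)).exists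
      have := huniq _ k j (Or.inr (hμ k)) hk
      omega
  · rw [hνI]
    obtain ⟨-, ε, hε, h⟩ := hν k
    exact ⟨ε, hε, h⟩

lemma near {m : ℕ} (hm : 3 ≤ m) {μ : ℝ} (hμ : 0 < μ) {ρ θ : ℝ → ℝ}
    (S : PSol (am m) (pm m) ρ θ) (h0 : ρ 0 = Real.log (2 * μ ^ 2)) {T : ℝ} (hT : 0 ≤ T)
    {U : Set (ℝ × ℝ)} (hU : IsOpen U) (hmem : (ρ T, θ T) ∈ U) :
    ∀ᶠ x in 𝓝 μ, 0 < x ∧ ∃ ρ' θ' : ℝ → ℝ, PSol (am m) (pm m) ρ' θ' ∧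
      ρ' 0 = Real.log (2 * x ^ 2) ∧ (ρ' T, θ' T) ∈ U := by
  obtain ⟨ε, hε, hball⟩ := Metric.isOpen_iff.1 hU _ hmem
  obtain ⟨δ, hδ, hd⟩ := PSol_cont S hT hε
  have hc : ContinuousAt (fun x : ℝ => Real.log (2 * x ^ 2)) μ := by
    apply ContinuousAt.log (by fun_prop); positivity
  have h1 := Metric.continuousAt_iff'.1 hc δ hδ
  filter_upwards [h1, lt_mem_nhds hμ] with x hx hx0
  obtain ⟨ρ', θ', S', h0'⟩ := PSol_exists (am_ge hm) (pm_pos hm) (pm_le hm) (Real.log (2 * x ^ 2))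
  refine ⟨hx0, ρ', θ', S', h0', hball ?_⟩
  obtain ⟨e1, e2⟩ := hd ρ' θ' S' (by rw [h0, h0']; exact hx)
  rw [Metric.mem_ball, Prod.dist_eq]
  exact max_lt e1 e2

lemma getS {m : ℕ} (hm : 3 ≤ m) (μ : ℝ) : ∃ ρ θ : ℝ → ℝ, PSol (am m) (pm m) ρ θ ∧
    ρ 0 = Real.log (2 * μ ^ 2) :=
  PSol_exists (am_ge hm) (pm_pos hm) (pm_le hm) _

theorem main_topo (m : ℕ) (hm : 3 ≤ m) :
    (∀ k : ℕ, (setA m k).Nonempty ∧ BddAbove (setA m k) ∧ IsOpen (setA m k)) ∧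
    (∀ k : ℕ, sSup (setA m k) ∈ setI m k) ∧
    StrictMono (fun k : ℕ => sSup (setA m k)) ∧
    Tendsto (fun k : ℕ => sSup (setA m k)) atTop atTop ∧
    (∀ k : ℕ, BddAbove (setI m k) ∧
      ∃ ε : ℝ, 0 < ε ∧
        Set.Ioo (sSup (setI m k)) (sSup (setI m k) + ε) ⊆ setA m (k + 1)) := by
  have hpos : ∀ {k μ}, (μ ∈ setA m k ∨ μ ∈ setI m k) → 0 < μ := by
    rintro k μ (h | h)
    · exact h.1
    · exact h.1
  apply topo
  · exact fun k μ h => h.1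
  · intro μ hμ
    obtain ⟨ρ, θ, S, h0⟩ := getS hm μ
    obtain ⟨k, h⟩ := S.total
    exact ⟨k, by rwa [mem_setA_iff hm hμ S h0, mem_setI_iff hm hμ S h0]⟩
  · intro μ k l h1 h2
    have hμ := hpos h1
    obtain ⟨ρ, θ, S, h0⟩ := getS hm μ
    rw [mem_setA_iff hm hμ S h0, mem_setI_iff hm hμ S h0] at h1 h2
    rcases h1 with h1 | h1 <;> rcases h2 with h2 | h2
    · exact PSol.InA.unique S h1 h2
    · exact (PSol.not_InA_InI k l h1 h2).elim
    · exact (PSol.not_InA_InI l k h2 h1).elim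
    · exact PSol.InI.unique S h1 h2
  · intro k
    rw [isOpen_iff_mem_nhds]
    intro μ h
    have hμ := h.1
    obtain ⟨ρ, θ, S, h0⟩ := getS hm μ
    obtain ⟨T, hT, h1, h2, h3⟩ := (mem_setA_iff hm hμ S h0).1 h
    have hU : IsOpen {x : ℝ × ℝ | (Real.exp x.1 * (En (pm m) T x.1 / (pm m + 1)
        - am m * Real.sin (2 * x.2)) / 2 < 0 ∧ -(k : ℝ) * π < x.2) ∧
          x.2 < -(k : ℝ) * π + π / 2} := by
      unfold En
      refine IsOpen.and (IsOpen.and ?_ ?_) ?_ <;> refine isOpen_lt ?_ ?_ <;> fun_prop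
    filter_upwards [near hm hμ S h0 hT.le hU ⟨⟨h1, h2⟩, h3⟩] with x hx
    obtain ⟨hx0, ρ', θ', S', h0', ⟨g1, g2⟩, g3⟩ := hx
    exact (mem_setA_iff hm hx0 S' h0').2 ⟨T, hT, g1, g2, g3⟩
  · intro k μ h
    have hμ := h.1
    obtain ⟨ρ, θ, S, h0⟩ := getS hm μ
    have hI := (mem_setI_iff hm hμ S h0).1 h
    obtain ⟨⟨T1, hT1, d1⟩, d2, -⟩ := PSol.InI.decay' S hI
    have ha := am_ge hm
    have hpp : 0 < am m / 2 * Real.exp (-(6 * am m)) := by positivity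
    obtain ⟨T2, hT2, d3⟩ := d2 (am m / 2 * Real.exp (-(6 * am m)) / 2) (by positivity)
    set T := max T1 T2 with hTd
    have hT : 1 ≤ T := hT1.trans (le_max_left _ _)
    have e1 := d1 T (le_max_left _ _)
    have e2 := d3 T (le_max_right _ _)
    have e3 := hI.2.1 T (by linarith)
    have hU : IsOpen {x : ℝ × ℝ | (En (pm m) T x.1 < am m / 2 * Real.exp (-(6 * am m))
        ∧ -(k : ℝ) * π < x.2) ∧ x.2 < -(k : ℝ) * π + π / 4} := by
      unfold En
      refine IsOpen.and (IsOpen.and ?_ ?_) ?_ <;> refine isOpen_lt ?_ ?_ <;> fun_prop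
    filter_upwards [near hm hμ S h0 (by linarith) hU
      ⟨⟨show En (pm m) T (ρ T) < _ by linarith, e3⟩, e1⟩] with x hx
    obtain ⟨hx0, ρ', θ', S', h0', ⟨g1, g2⟩, g3⟩ := hx
    rw [mem_setA_iff hm hx0 S' h0', mem_setI_iff hm hx0 S' h0', mem_setA_iff hm hx0 S' h0']
    exact S'.local_tri k hT g2 g3 (le_of_lt g1)
  · obtain ⟨M, hM⟩ := small_A (am m) (pm m) (am_ge hm) (pm_pos hm)
    refine ⟨Real.exp (M / 2) / 2, by positivity, fun μ h1 h2 => ?_⟩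
    obtain ⟨ρ, θ, S, h0⟩ := getS hm μ
    rw [mem_setA_iff hm h1 S h0]
    refine hM ρ θ S ?_
    rw [h0, Real.log_le_iff_le_exp (by positivity)]
    have : Real.exp M = Real.exp (M / 2) ^ 2 := by
      rw [← Real.exp_nat_mul]; congr 1; push_cast; ring
    rw [this]
    nlinarith [Real.exp_pos (M / 2)]
  · intro k
    obtain ⟨M, hM⟩ := large_low (am m) (pm m) (pm_pos hm) k
    refine ⟨Real.exp (M / 2), fun μ h1 h2 j hj => ?_⟩
    obtain ⟨ρ, θ, S, h0⟩ := getS hm μ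
    rw [mem_setA_iff hm h2 S h0, mem_setI_iff hm h2 S h0]
    refine S.low_angle hj zero_le_one (hM ρ θ S ?_)
    rw [h0, Real.le_log_iff_exp_le (by positivity)]
    have : Real.exp M = Real.exp (M / 2) ^ 2 := by
      rw [← Real.exp_nat_mul]; congr 1; push_cast; ring
    rw [this]
    nlinarith [Real.exp_pos (M / 2)]
  · exact fun k μ h => h.1

/-! ### Asymptotics -/

namespace PSol

variable {a p : ℝ} {ρ θ : ℝ → ℝ}

lemma rho_abs (S : PSol a p ρ θ) (t : ℝ) : ρ t = ρ |t| := by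
  rcases le_total 0 t with h | h
  · rw [abs_of_nonneg h]
  · rw [abs_of_nonpos h, (PSol_symm S t).1]

lemma I_decay (S : PSol a p ρ θ) {k : ℕ} (h : InI a p ρ θ k) :
    ∃ C, ∀ t, ρ t ≤ C - 2 * a * |t| := by
  obtain ⟨-, -, C, hC⟩ := InI.decay' S h
  exact ⟨C, fun t => by rw [S.rho_abs]; exact hC |t| (abs_nonneg t)⟩

lemma tend0 {ρ w : ℝ → ℝ} {a C : ℝ} (ha : 1 / 2 ≤ a) (hρ : ∀ t, ρ t ≤ C - 2 * a * |t|)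
    (hw : ∀ t, |w t| ≤ Real.exp (ρ t / 2)) :
    Tendsto w atTop (𝓝 0) ∧ Tendsto w atBot (𝓝 0) := by
  have h1 : ∀ t, ‖w t‖ ≤ Real.exp (C / 2 - a * |t|) := by
    intro t
    rw [Real.norm_eq_abs]
    refine (hw t).trans (Real.exp_le_exp.2 ?_)
    linarith [hρ t]
  have h2 : Tendsto (fun x : ℝ => Real.exp (C / 2 - a * x)) atTop (𝓝 0) := by
    apply Real.tendsto_exp_atBot.comp
    have : Tendsto (fun x : ℝ => a * x) atTop atTop :=
      tendsto_id.const_mul_atTop (by linarith)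
    exact tendsto_const_nhds.add_atBot (tendsto_neg_atTop_atBot.comp this)
  exact ⟨squeeze_zero_norm h1 (h2.comp tendsto_abs_atTop_atTop),
    squeeze_zero_norm h1 (h2.comp tendsto_abs_atBot_atTop)⟩

lemma A_lower (S : PSol a p ρ θ) {k : ℕ} (h : InA a p ρ θ k) :
    ∃ c, 0 < c ∧ ∀ t, c ≤ Real.exp (ρ t) := by
  obtain ⟨T, hT, hl⟩ := InA.later S h
  have ha := S.ha
  set η := -Hp a p ρ θ T with hη
  have hη0 : 0 < η := by linarith [(hl T le_rfl).1]
  refine ⟨min (2 * η / a) (Real.exp (ρ 0 - 2 * a * T)), by positivity, fun t => ?_⟩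
  rw [S.rho_abs t]
  rcases le_total T |t| with ht | ht
  · refine (min_le_left _ _).trans ?_
    have h1 := S.Hp_anti hT.le ht
    have h2 : Hp a p ρ θ |t| = Real.exp (ρ |t|) * hh a p ρ θ |t| / 2 := rfl
    have h3 : -a ≤ hh a p ρ θ |t| := by
      unfold hh
      have e1 : 0 < En p |t| (ρ |t|) / (p + 1) := div_pos (En_pos _ _ _) (by linarith [S.hp])
      have e2 := Real.sin_le_one (2 * θ |t|)
      nlinarith
    rw [div_le_iff₀ (by linarith)]
    have := mul_le_mul_of_nonneg_left h3 (Real.exp_pos (ρ |t|)).le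
    linarith
  · refine (min_le_right _ _).trans (Real.exp_le_exp.2 ?_)
    have := (S.rho_lip (abs_nonneg t)).2
    nlinarith

lemma A_unbdd (S : PSol a p ρ θ) {k : ℕ} (h : InA a p ρ θ k) :
    ¬ ∃ M, ∀ t, Real.exp (ρ t) ≤ M := by
  rintro ⟨M, hM⟩
  obtain ⟨T, hT, hl⟩ := InA.later S h
  have ha := S.ha
  have hp := S.hp
  have hpi := Real.pi_pos
  have hM0 : 0 < M := (Real.exp_pos _).trans_le (hM 0)
  set η := -Hp a p ρ θ T with hη
  have hη0 : 0 < η := by linarith [(hl T le_rfl).1]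
  set c := 2 * η / M with hc
  have hc0 : 0 < c := by positivity
  have hsin : ∀ t, T ≤ t → c ≤ a * Real.sin (2 * θ t) := by
    intro t ht
    have h1 := S.Hp_anti hT.le ht
    have h2 : Hp a p ρ θ t = Real.exp (ρ t) * hh a p ρ θ t / 2 := rfl
    have h3 : -(a * Real.sin (2 * θ t)) ≤ hh a p ρ θ t := by
      unfold hh
      have e1 : 0 < En p t (ρ t) / (p + 1) := div_pos (En_pos _ _ _) (by linarith [S.hp])
      linarith
    have h5 : 0 < a * Real.sin (2 * θ t) := mul_pos (by linarith) (S.sin_pos (hl t ht).1)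
    rw [hc, div_le_iff₀ hM0]
    have := mul_le_mul_of_nonneg_left h3 (Real.exp_pos (ρ t)).le
    have := mul_le_mul_of_nonneg_left (hM t) h5.le
    linarith
  set T' := max T (Real.log M + 1 - Real.log (c / 2) / p) with hT'
  have hTT : T ≤ T' := le_max_left _ _
  have hder : ∀ t, T' ≤ t → c / 2 ≤ a * Real.sin (2 * θ t) - En p t (ρ t) := by
    intro t ht
    have h1 := hsin t ((le_max_left _ _).trans ht)
    have h2 : En p t (ρ t) ≤ c / 2 := by
      unfold En
      rw [← Real.le_log_iff_exp_le (by positivity)]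
      have e1 : ρ t ≤ Real.log M := (Real.le_log_iff_exp_le hM0).2 (hM t)
      have e2 := lc_ge t
      have e3 : Real.log M + 1 - Real.log (c / 2) / p ≤ t := (le_max_right _ _).trans ht
      have e4 : ρ t - lc t ≤ Real.log (c / 2) / p := by linarith
      rw [le_div_iff₀ hp] at e4
      linarith
    linarith
  have := le_sub_of_der (s := T') (t := T' + π / c) (by linarith [div_pos hpi hc0]) S.dth
    (fun x h1 _ => hder x h1)
  have e : c / 2 * (T' + π / c - T') = π / 2 := by field_simp; ring
  rw [e] at this
  have h1 := (hl T' (le_max_left _ _)).2.1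
  have h2 := (hl (T' + π / c) (by linarith [div_pos hpi hc0, hTT])).2.2
  linarith

lemma A_upper (S : PSol a p ρ θ) {k : ℕ} (h : InA a p ρ θ k) :
    ∃ C T : ℝ, 0 < C ∧ 0 < T ∧ ∀ t : ℝ, T ≤ |t| → Real.exp (ρ t) ≤ C * Real.cosh t := by
  obtain ⟨T, hT, hl⟩ := InA.later S h
  have ha := S.ha
  have hp := S.hp
  refine ⟨Real.exp (Real.log ((p + 1) * a) / p), T, Real.exp_pos _, hT, fun t ht => ?_⟩
  rw [S.rho_abs t, ← Real.cosh_abs, ← exp_lc, ← Real.exp_add, Real.exp_le_exp]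
  have h1 := hh_neg_iff.1 (hl |t| ht).1
  unfold hh at h1
  have h2 : En p |t| (ρ |t|) / (p + 1) ≤ a := by
    have := Real.sin_le_one (2 * θ |t|)
    nlinarith
  rw [div_le_iff₀ (by linarith)] at h2
  unfold En at h2
  rw [← Real.le_log_iff_exp_le (by positivity), mul_comm a] at h2
  have : ρ |t| - lc |t| ≤ Real.log ((p + 1) * a) / p := by
    rw [le_div_iff₀ hp]; linarith
  linarith

end PSol

theorem main_I (m : ℕ) (hm : 3 ≤ m) : ∀ (k : ℕ) (μ : ℝ), μ ∈ setI m k →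
      ∀ u v : ℝ → ℝ, IsSolS2 m u v → u 0 = μ → v 0 = μ →
        (Tendsto u atTop (𝓝 0) ∧ Tendsto u atBot (𝓝 0) ∧
          Tendsto v atTop (𝓝 0) ∧ Tendsto v atBot (𝓝 0)) ∧
        ∃ C T : ℝ, 0 < C ∧ 0 < T ∧
          ∀ t : ℝ, T ≤ |t| →
            (u t) ^ 2 + (v t) ^ 2 ≤ C * Real.exp (-((m : ℝ) - 2) * |t|) := by
  intro k μ h u v hs hu hv
  have hμ := h.1
  obtain ⟨ρ, θ, S, h0, rfl, rfl⟩ := polar_of_sol hm hs hμ hu hv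
  obtain ⟨C, hC⟩ := S.I_decay ((mem_setI_iff hm hμ S h0).1 h)
  have t1 := PSol.tend0 (w := uu ρ θ) (am_ge hm) hC (fun t => by
    unfold uu
    rw [abs_mul, abs_of_pos (Real.exp_pos _)]
    nlinarith [Real.exp_pos (ρ t / 2), Real.abs_cos_le_one (θ t)])
  have t2 := PSol.tend0 (w := vv ρ θ) (am_ge hm) hC (fun t => by
    unfold vv
    rw [abs_mul, abs_of_pos (Real.exp_pos _)]
    nlinarith [Real.exp_pos (ρ t / 2), Real.abs_sin_le_one (θ t)])
  refine ⟨⟨t1.1, t1.2, t2.1, t2.2⟩, Real.exp C, 1, Real.exp_pos _, one_pos, fun t _ => ?_⟩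
  rw [uv_sq, ← Real.exp_add, Real.exp_le_exp]
  have := hC t
  unfold am at this
  linarith

theorem main_A (m : ℕ) (hm : 3 ≤ m) : ∀ (k : ℕ) (μ : ℝ), μ ∈ setA m k →
      ∀ u v : ℝ → ℝ, IsSolS2 m u v → u 0 = μ → v 0 = μ →
        (∃ c : ℝ, 0 < c ∧ ∀ t : ℝ, c ≤ (u t) ^ 2 + (v t) ^ 2) ∧
        (¬ ∃ M : ℝ, ∀ t : ℝ, (u t) ^ 2 + (v t) ^ 2 ≤ M) ∧
        ∃ C T : ℝ, 0 < C ∧ 0 < T ∧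
          ∀ t : ℝ, T ≤ |t| → (u t) ^ 2 + (v t) ^ 2 ≤ C * Real.cosh t := by
  intro k μ h u v hs hu hv
  have hμ := h.1
  obtain ⟨ρ, θ, S, h0, rfl, rfl⟩ := polar_of_sol hm hs hμ hu hv
  have hA := (mem_setA_iff hm hμ S h0).1 h
  simp only [uv_sq]
  exact ⟨S.A_lower hA, S.A_unbdd hA, S.A_upper hA⟩


theorem stmt19 (m : ℕ) (hm : 3 ≤ m) :
    (∀ k : ℕ, (setA m k).Nonempty ∧ BddAbove (setA m k) ∧ IsOpen (setA m k)) ∧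
    (∀ k : ℕ, sSup (setA m k) ∈ setI m k) ∧
    StrictMono (fun k : ℕ => sSup (setA m k)) ∧
    Tendsto (fun k : ℕ => sSup (setA m k)) atTop atTop ∧
    (∀ k : ℕ, BddAbove (setI m k) ∧
      ∃ ε : ℝ, 0 < ε ∧
        Set.Ioo (sSup (setI m k)) (sSup (setI m k) + ε) ⊆ setA m (k + 1)) ∧
    (∀ (k : ℕ) (μ : ℝ), μ ∈ setI m k →
      ∀ u v : ℝ → ℝ, IsSolS2 m u v → u 0 = μ → v 0 = μ →
        (Tendsto u atTop (𝓝 0) ∧ Tendsto u atBot (𝓝 0) ∧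
          Tendsto v atTop (𝓝 0) ∧ Tendsto v atBot (𝓝 0)) ∧
        ∃ C T : ℝ, 0 < C ∧ 0 < T ∧
          ∀ t : ℝ, T ≤ |t| →
            (u t) ^ 2 + (v t) ^ 2 ≤ C * Real.exp (-((m : ℝ) - 2) * |t|)) ∧
    (∀ (k : ℕ) (μ : ℝ), μ ∈ setA m k →
      ∀ u v : ℝ → ℝ, IsSolS2 m u v → u 0 = μ → v 0 = μ →
        (∃ c : ℝ, 0 < c ∧ ∀ t : ℝ, c ≤ (u t) ^ 2 + (v t) ^ 2) ∧
        (¬ ∃ M : ℝ, ∀ t : ℝ, (u t) ^ 2 + (v t) ^ 2 ≤ M) ∧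
        ∃ C T : ℝ, 0 < C ∧ 0 < T ∧
          ∀ t : ℝ, T ≤ |t| → (u t) ^ 2 + (v t) ^ 2 ≤ C * Real.cosh t) := by
  obtain ⟨h1, h2, h3, h4, h5⟩ := main_topo m hm
  exact ⟨h1, h2, h3, h4, h5, main_I m hm, main_A m hm⟩
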